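/- arXiv:2107.10785 — 3 statements merged into one kernel-verified Lean document; each statement's English description precedes it below -/
import Mathlib

section
/- Let Ω ⊂ ℝ^m be open and bounded and let u ∈ C^{k'}(Ω̄). Then for every ε > 0 there exists v_ε ∈ C^{k'}(Ω̄) such that: (1) ‖u − v_ε‖_{C^{k'}(Ω̄)} ≤ ε; (2) v_ε is piecewise a polynomial of order k'; (3) v_ε agrees with u, together with all of its derivatives of order 0 ≤ ℓ ≤ k', on ∂Ω. -/
open MeasureTheory Metric Set Matrix Filter

/-- Multi-indices on `Fin m` of total degree `k`. -/
def mIdx (m k : ℕ) : Finset (Fin m → ℕ) :=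
  (Fintype.piFinset fun _ => Finset.range (k + 1)).filter fun α => ∑ i, α i = k

/-- Partial derivative in the `i`-th coordinate direction. -/
noncomputable def pderiv' {m : ℕ} {E : Type*} [NormedAddCommGroup E] [NormedSpace ℝ E]
    (i : Fin m) (f : (Fin m → ℝ) → E) : (Fin m → ℝ) → E :=
  fun x => fderiv ℝ f x (Pi.single i 1)

/-- Iterated partial derivative `∂^α`. -/
noncomputable def mderiv {m : ℕ} {E : Type*} [NormedAddCommGroup E] [NormedSpace ℝ E]
    (α : Fin m → ℕ) (f : (Fin m → ℝ) → E) : (Fin m → ℝ) → E :=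
  (List.finRange m).foldr (fun i g => (pderiv' i)^[α i] g) f

/-- The symbol `𝔸(ξ) = Σ_{|α|=k} ξ^α A_α` of a homogeneous operator of order `k`. -/
noncomputable def opSymb {m n N : ℕ} (k : ℕ) (A : (Fin m → ℕ) → Matrix (Fin N) (Fin n) ℝ)
    (ξ : Fin m → ℝ) : Matrix (Fin N) (Fin n) ℝ :=
  ∑ α ∈ mIdx m k, (∏ i, ξ i ^ α i) • A α

/-- The wave cone `Λ_𝒜 = ⋃_{ξ ≠ 0} ker 𝔸(ξ)`. -/
def waveCone {m n N : ℕ} (k : ℕ) (A : (Fin m → ℕ) → Matrix (Fin N) (Fin n) ℝ) :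
    Set (Fin n → ℝ) :=
  {η | ∃ ξ : Fin m → ℝ, ξ ≠ 0 ∧ (opSymb k A ξ).mulVec η = 0}

/-- `𝒜` has constant rank. -/
def ConstRank {m n N : ℕ} (k : ℕ) (A : (Fin m → ℕ) → Matrix (Fin N) (Fin n) ℝ) : Prop :=
  ∃ r, ∀ ξ : Fin m → ℝ, ξ ≠ 0 → (opSymb k A ξ).rank = r

/-- `𝒜` is balanced: the wave cone spans `ℝ^n`. -/
def IsBalanced {m n N : ℕ} (k : ℕ) (A : (Fin m → ℕ) → Matrix (Fin N) (Fin n) ℝ) : Prop :=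
  Submodule.span ℝ (waveCone k A) = ⊤

/-- `𝓑` (order `k'`, coefficients `B`) is a potential for `𝒜` (order `k`, coefficients `A`). -/
def IsPotential {m n n' N : ℕ} (k k' : ℕ) (A : (Fin m → ℕ) → Matrix (Fin N) (Fin n) ℝ)
    (B : (Fin m → ℕ) → Matrix (Fin n) (Fin n') ℝ) : Prop :=
  ∀ ξ : Fin m → ℝ, ξ ≠ 0 →
    LinearMap.ker (opSymb k A ξ).mulVecLin = LinearMap.range (opSymb k' B ξ).mulVecLin

/-- Pointwise action `𝓑(V)(x) = Σ_{|α|=k'} B_α ∂^α V (x)`. -/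
noncomputable def opApply {m n n' : ℕ} (k' : ℕ) (B : (Fin m → ℕ) → Matrix (Fin n) (Fin n') ℝ)
    (V : (Fin m → ℝ) → (Fin n' → ℝ)) : (Fin m → ℝ) → (Fin n → ℝ) :=
  fun x => ∑ α ∈ mIdx m k', (B α).mulVec (mderiv α V x)

/-- `𝒜(u) = 0` on `Ω` in the sense of distributions. -/
def AFree {m n N : ℕ} (k : ℕ) (A : (Fin m → ℕ) → Matrix (Fin N) (Fin n) ℝ)
    (Ω : Set (Fin m → ℝ)) (u : (Fin m → ℝ) → (Fin n → ℝ)) : Prop :=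
  ∀ φ : (Fin m → ℝ) → (Fin N → ℝ), ContDiff ℝ (⊤ : ℕ∞) φ → HasCompactSupport φ → tsupport φ ⊆ Ω →
    ∫ x in Ω, u x ⬝ᵥ (∑ α ∈ mIdx m k, (A α)ᵀ.mulVec (mderiv α φ x)) = 0

/-- `f` coincides with a polynomial of degree at most `d`. -/
def IsPolyDegLE {m : ℕ} (d : ℕ) (f : (Fin m → ℝ) → ℝ) : Prop :=
  ∃ p : MvPolynomial (Fin m) ℝ, p.totalDegree ≤ d ∧ ∀ x, f x = MvPolynomial.eval x p

/-- `f` is piecewise a polynomial of degree (at most) `d` on `Ω`. -/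
def PiecewisePolyOn {m : ℕ} (d : ℕ) (Ω : Set (Fin m → ℝ)) (f : (Fin m → ℝ) → ℝ) : Prop :=
  ∃ U : ℕ → Set (Fin m → ℝ), (∀ j, IsOpen (U j)) ∧ (∀ j, U j ⊆ Ω) ∧
    (Pairwise fun i j => Disjoint (U i) (U j)) ∧ volume (Ω \ ⋃ j, U j) = 0 ∧
    ∀ j, ∃ p : MvPolynomial (Fin m) ℝ, p.totalDegree ≤ d ∧ ∀ x ∈ U j, f x = MvPolynomial.eval x p

/-- Bound on the `W^{k',∞} ∩ C^{k'-1}(Ω̄)` norm: all derivatives of order `< k'` are bounded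
by `C` on `Ω̄` and the order-`k'` derivatives are essentially bounded by `C` on `Ω`. -/
def NormLeWC {m n' : ℕ} (k' : ℕ) (Ω : Set (Fin m → ℝ)) (V : (Fin m → ℝ) → (Fin n' → ℝ))
    (C : ℝ) : Prop :=
  (∀ j < k', ∀ x ∈ closure Ω, ‖iteratedFDerivWithin ℝ j V (closure Ω) x‖ ≤ C) ∧
  (∀ᵐ x ∂(volume.restrict Ω), ‖iteratedFDeriv ℝ k' V x‖ ≤ C)

/-- `‖V - W‖_{C^{k'-1}(Ω̄)} ≤ ε` (all derivatives of order `< k'`). -/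
def CloseCLT {m n' : ℕ} (k' : ℕ) (Ω : Set (Fin m → ℝ)) (V W : (Fin m → ℝ) → (Fin n' → ℝ))
    (ε : ℝ) : Prop :=
  ∀ j < k', ∀ x ∈ closure Ω,
    ‖iteratedFDerivWithin ℝ j V (closure Ω) x - iteratedFDerivWithin ℝ j W (closure Ω) x‖ ≤ ε

/-- `V` and `W` agree, together with all derivatives of order `< k'`, on `∂Ω`. -/
def AgreeOnBoundaryLT {m n' : ℕ} (k' : ℕ) (Ω : Set (Fin m → ℝ))
    (V W : (Fin m → ℝ) → (Fin n' → ℝ)) : Prop :=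
  ∀ j < k', ∀ x ∈ frontier Ω,
    iteratedFDerivWithin ℝ j V (closure Ω) x = iteratedFDerivWithin ℝ j W (closure Ω) x

/-- `E` is essentially open in `Ω`. -/
def EssOpenIn {m : ℕ} (Ω E : Set (Fin m → ℝ)) : Prop :=
  volume (frontier E ∩ Ω) = 0

/-- A `Λ`-convex function. -/
def LamConvex {n : ℕ} (Λ : Set (Fin n → ℝ)) (f : (Fin n → ℝ) → ℝ) : Prop :=
  ∀ a b : Fin n → ℝ, a - b ∈ Λ → ∀ t : ℝ, t ∈ Set.Icc (0:ℝ) 1 →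
    f (t • a + (1 - t) • b) ≤ t * f a + (1 - t) * f b

/-- The `Λ`-convex hull of a (compact) set `K`: barycentres of laminates supported in `K`. -/
def lamHull {n : ℕ} (Λ : Set (Fin n → ℝ)) (K : Set (Fin n → ℝ)) : Set (Fin n → ℝ) :=
  {x | ∃ ν : Measure (Fin n → ℝ), IsProbabilityMeasure ν ∧ ν Kᶜ = 0 ∧
        x = ∫ y, y ∂ν ∧
        ∀ f : (Fin n → ℝ) → ℝ, Continuous f → LamConvex Λ f → f x ≤ ∫ y, f y ∂ν}

/-- The `Λ`-convex hull of an open set. -/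
def lamHullOpen {n : ℕ} (Λ : Set (Fin n → ℝ)) (U : Set (Fin n → ℝ)) : Set (Fin n → ℝ) :=
  ⋃ K ∈ {K : Set (Fin n → ℝ) | IsCompact K ∧ K ⊆ U}, lamHull Λ K

universe u

theorem ContDiffAt.iteratedFDeriv_swap_last {E F : Type u} [NormedAddCommGroup E]
    [NormedSpace ℝ E] [NormedAddCommGroup F] [NormedSpace ℝ F] {n : ℕ} {f : E → F} {x : E}
    (hf : ContDiffAt ℝ (n + 2 : ℕ) f x) (v : Fin (n + 2) → E) :
    iteratedFDeriv ℝ (n + 2) f x (v ∘ Equiv.swap (Fin.last n).castSucc (Fin.last n).succ) =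
      iteratedFDeriv ℝ (n + 2) f x v := by
  have hev : ∀ᶠ y in nhds x, ContDiffAt ℝ (n + 2 : ℕ) f y :=
    hf.eventually (fun h => ENat.natCast_ne_top (n + 2) (WithTop.coe_injective h))
  have hsymm : ∀ᶠ y in nhds x, IsSymmSndFDerivAt ℝ f y := by
    filter_upwards [hev] with y hy
    refine hy.isSymmSndFDerivAt ?_
    rw [minSmoothness_of_isRCLikeNormedField]
    exact_mod_cast Nat.le_add_left 2 n
  have hc : ContDiffAt ℝ n (fderiv ℝ (fderiv ℝ f)) x := by
    refine ContDiffAt.fderiv_right (m := n) (n := (n + 1 : ℕ)) ?_ (by norm_cast)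
    exact hf.fderiv_right (by norm_cast)
  have hflip : fderiv ℝ (fderiv ℝ f) =ᶠ[nhds x]
      (ContinuousLinearMap.flipₗᵢ ℝ E E F : _ →L[ℝ] _) ∘ fderiv ℝ (fderiv ℝ f) := by
    filter_upwards [hsymm] with y hy
    ext a b
    exact hy.eq a b
  have key : iteratedFDeriv ℝ n (fderiv ℝ (fderiv ℝ f)) x =
      (ContinuousLinearMap.flipₗᵢ ℝ E E F : _ →L[ℝ] _).compContinuousMultilinearMap
        (iteratedFDeriv ℝ n (fderiv ℝ (fderiv ℝ f)) x) := by
    conv_lhs => rw [hflip.iteratedFDeriv ℝ n |>.eq_of_nhds]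
    exact ContinuousLinearMap.iteratedFDeriv_comp_left _ hc le_rfl
  simp only [iteratedFDeriv_succ_apply_right]
  have h1 : Fin.init (Fin.init (v ∘ Equiv.swap (Fin.last n).castSucc (Fin.last n).succ)) =
      Fin.init (Fin.init v) := by
    ext i
    simp only [Fin.init, Function.comp]
    rw [Equiv.swap_apply_of_ne_of_ne]
    · simp [Fin.ext_iff, i.2.ne]
    · simp only [ne_eq, Fin.ext_iff, Fin.val_castSucc, Fin.val_succ, Fin.val_last]; omega
  rw [h1]
  have h2 : Fin.init (v ∘ Equiv.swap (Fin.last n).castSucc (Fin.last n).succ) (Fin.last n) =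
      v (Fin.last (n + 1)) := by
    simp [Fin.init]
  have h3 : (v ∘ Equiv.swap (Fin.last n).castSucc (Fin.last n).succ) (Fin.last (n + 1)) =
      Fin.init v (Fin.last n) := by
    rw [← Fin.succ_last]
    simp [Fin.init, -Fin.succ_last]
  rw [h2, h3]
  conv_lhs => rw [key]
  rfl

theorem ContDiffAt.iteratedFDeriv_swap_adjacent {E : Type u} [NormedAddCommGroup E]
    [NormedSpace ℝ E] {x : E} (n : ℕ) {F : Type u} [NormedAddCommGroup F] [NormedSpace ℝ F]
    {f : E → F} (hf : ContDiffAt ℝ (n + 1 : ℕ) f x) (i : Fin n) (v : Fin (n + 1) → E) :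
    iteratedFDeriv ℝ (n + 1) f x (v ∘ Equiv.swap i.castSucc i.succ) =
      iteratedFDeriv ℝ (n + 1) f x v := by
  induction n generalizing F with
  | zero => exact i.elim0
  | succ n ih =>
    induction i using Fin.lastCases with
    | last => exact hf.iteratedFDeriv_swap_last v
    | cast i =>
      have hf' : ContDiffAt ℝ (n + 1 : ℕ) (fderiv ℝ f) x := hf.fderiv_right (by norm_cast)
      rw [iteratedFDeriv_succ_apply_right (v ∘ _), iteratedFDeriv_succ_apply_right v]
      have h1 : Fin.init (v ∘ Equiv.swap i.castSucc.castSucc i.castSucc.succ) =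
          Fin.init v ∘ Equiv.swap i.castSucc i.succ := by
        ext j
        simp only [Fin.init, Function.comp, ← Fin.castSucc_succ]
        rw [← (Fin.castSucc_injective _).swap_apply]
      have h2 : (v ∘ Equiv.swap i.castSucc.castSucc i.castSucc.succ) (Fin.last (n + 1)) =
          v (Fin.last (n + 1)) := by
        simp only [Function.comp]
        rw [Equiv.swap_apply_of_ne_of_ne]
        · exact (Fin.castSucc_lt_last _).ne'
        · rw [← Fin.castSucc_succ]
          exact (Fin.castSucc_lt_last _).ne'
      rw [h1, h2, ih hf']

/-- The iterated derivative of order `n` of a real `C^n` function is symmetric. -/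
theorem ContDiffAt.iteratedFDeriv_comp_perm_real {E F : Type u} [NormedAddCommGroup E]
    [NormedSpace ℝ E] [NormedAddCommGroup F] [NormedSpace ℝ F] {n : ℕ} {f : E → F} {x : E}
    (hf : ContDiffAt ℝ n f x) (v : Fin n → E) (σ : Equiv.Perm (Fin n)) :
    iteratedFDeriv ℝ n f x (v ∘ σ) = iteratedFDeriv ℝ n f x v := by
  cases n with
  | zero => rw [Subsingleton.elim (v ∘ σ) v]
  | succ n =>
    have hσ : σ ∈ Submonoid.closure
        (Set.range fun i : Fin n => Equiv.swap i.castSucc i.succ) := by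
      rw [Equiv.Perm.mclosure_swap_castSucc_succ]
      trivial
    induction hσ using Submonoid.closure_induction generalizing v with
    | mem τ hτ =>
      obtain ⟨i, rfl⟩ := hτ
      exact hf.iteratedFDeriv_swap_adjacent n i v
    | one => rfl
    | mul τ ρ _ _ hτ hρ =>
      rw [Equiv.Perm.coe_mul, ← Function.comp_assoc, hρ, hτ]

theorem MvPolynomial.contDiff_eval {m : ℕ} (p : MvPolynomial (Fin m) ℝ) {n : WithTop ℕ∞} :
    ContDiff ℝ n fun y : Fin m → ℝ => MvPolynomial.eval y p := by
  induction p using MvPolynomial.induction_on with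
  | C a => simpa using contDiff_const
  | add p q hp hq => simpa using hp.add hq
  | mul_X p i hp => simpa using hp.mul (contDiff_apply ℝ ℝ i)

/-- A multilinear form on the diagonal, centred at `x`, is a polynomial. -/
theorem exists_mvPolynomial_eval_eq_diagonal {m i : ℕ}
    (M : ContinuousMultilinearMap ℝ (fun _ : Fin i => Fin m → ℝ) ℝ) (x : Fin m → ℝ) :
    ∃ p : MvPolynomial (Fin m) ℝ, p.totalDegree ≤ i ∧
      ∀ y, MvPolynomial.eval y p = M fun _ => y - x := by
  classical
  refine ⟨∑ r : Fin i → Fin m, MvPolynomial.C (M fun j => Pi.single (r j) 1) *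
    ∏ j, (MvPolynomial.X (r j) - MvPolynomial.C (x (r j))), ?_, fun y => ?_⟩
  · refine MvPolynomial.totalDegree_finsetSum_le fun r _ => ?_
    refine (MvPolynomial.totalDegree_mul _ _).trans ?_
    rw [MvPolynomial.totalDegree_C, zero_add]
    refine (MvPolynomial.totalDegree_finsetProd _ _).trans ?_
    refine (Finset.sum_le_card_nsmul _ _ 1 fun j _ => ?_).trans (by simp)
    refine (MvPolynomial.totalDegree_sub _ _).trans ?_
    simp
  · have hy : (fun _ : Fin i => y - x) =
        fun _ => ∑ l : Fin m, (y l - x l) • (Pi.single l (1 : ℝ) : Fin m → ℝ) := by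
      funext _
      ext l
      simp [Finset.sum_apply, Pi.single_apply]
    rw [hy, M.map_sum]
    simp only [map_sum, map_mul, map_prod, map_sub, MvPolynomial.eval_X, MvPolynomial.eval_C]
    refine Finset.sum_congr rfl fun r _ => ?_
    rw [M.map_smul_univ (fun j => y (r j) - x (r j)), smul_eq_mul, mul_comm]

/-- The Taylor polynomial of order `k`. -/
theorem ContDiffAt.exists_taylor_mvPolynomial {m k : ℕ} {f : (Fin m → ℝ) → ℝ} {x : Fin m → ℝ}
    (hf : ContDiffAt ℝ k f x) :
    ∃ p : MvPolynomial (Fin m) ℝ, p.totalDegree ≤ k ∧ ∀ j ≤ k,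
      iteratedFDeriv ℝ j (fun y => MvPolynomial.eval y p) x = iteratedFDeriv ℝ j f x := by
  let P : FormalMultilinearSeries ℝ (Fin m → ℝ) ℝ := fun n =>
    if n ≤ k then ((n.factorial : ℝ)⁻¹) • iteratedFDeriv ℝ n f x else 0
  choose q hqd hq using fun n => exists_mvPolynomial_eval_eq_diagonal (P n) x
  refine ⟨∑ n ∈ Finset.range (k + 1), q n, ?_, ?_⟩
  · refine MvPolynomial.totalDegree_finsetSum_le fun n hn => (hqd n).trans ?_
    simpa [Nat.lt_succ_iff] using hn
  · have hrad : P.radius = ⊤ := by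
      refine P.radius_eq_top_of_eventually_eq_zero ?_
      filter_upwards [eventually_gt_atTop k] with n hn
      simp [P, hn.not_ge]
    have hball : HasFPowerSeriesOnBall
        (fun y => MvPolynomial.eval y (∑ n ∈ Finset.range (k + 1), q n)) P x ⊤ := by
      refine ⟨hrad.ge, ENNReal.zero_lt_top, fun {y} _ => ?_⟩
      have : MvPolynomial.eval (x + y) (∑ n ∈ Finset.range (k + 1), q n) =
          ∑ n ∈ Finset.range (k + 1), P n fun _ => y := by
        simp [hq]
      rw [this]
      refine hasSum_sum_of_ne_finset_zero fun n hn => ?_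
      have : ¬ n ≤ k := by simpa [Nat.lt_succ_iff] using hn
      simp [P, this]
    intro j hj
    ext v
    rw [hball.iteratedFDeriv_eq_sum_of_completeSpace]
    have hfj : ContDiffAt ℝ j f x := hf.of_le (by exact_mod_cast hj)
    have : ∀ σ : Equiv.Perm (Fin j), (P j fun i => v (σ i)) =
        (j.factorial : ℝ)⁻¹ * iteratedFDeriv ℝ j f x v := fun σ => by
      simp only [P, hj, if_true, _root_.smul_apply, smul_eq_mul]
      congr 1
      exact hfj.iteratedFDeriv_comp_perm_real v σ
    simp only [this, Finset.sum_const, Finset.card_univ, Fintype.card_perm, Fintype.card_fin,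
      nsmul_eq_mul]
    field_simp

theorem exists_contDiff_cutoff (m k : ℕ) : ∃ C : ℝ, 0 < C ∧ ∀ (x : Fin m → ℝ) (r : ℝ), 0 < r →
    ∃ φ : (Fin m → ℝ) → ℝ, ContDiff ℝ k φ ∧ tsupport φ ⊆ ball x r ∧
      (∀ y ∈ closedBall x (r / 2), φ y = 1) ∧
      ∀ j ≤ k, ∀ y, ‖iteratedFDeriv ℝ j φ y‖ ≤ C * (r⁻¹) ^ j := by
  let b : ContDiffBump (0 : Fin m → ℝ) := ⟨1 / 2, 3 / 4, by norm_num, by norm_num⟩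
  have hb : ContDiff ℝ k b := b.contDiff
  have hbd : ∀ j : ℕ, ∃ C, j ≤ k → ∀ y, ‖iteratedFDeriv ℝ j b y‖ ≤ C := fun j => by
    by_cases hj : j ≤ k
    · obtain ⟨C, hC⟩ := (b.hasCompactSupport.iteratedFDeriv (𝕜 := ℝ) j).exists_bound_of_continuous
        (hb.continuous_iteratedFDeriv (by exact_mod_cast hj))
      exact ⟨C, fun _ => hC⟩
    · exact ⟨0, fun h => absurd h hj⟩
  choose C hC using hbd
  refine ⟨∑ j ∈ Finset.range (k + 1), |C j| + 1, by positivity, fun x r hr => ?_⟩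
  let L : (Fin m → ℝ) →L[ℝ] (Fin m → ℝ) := r⁻¹ • ContinuousLinearMap.id ℝ _
  have hL : ‖L‖ ≤ r⁻¹ := by
    refine ContinuousLinearMap.opNorm_le_bound _ (by positivity) fun y => ?_
    simp [L, norm_smul, abs_of_pos hr]
  have hbL : ContDiff ℝ k (b ∘ L) := hb.comp L.contDiff
  have hsub : ∀ y, L (y - x) = r⁻¹ • (y - x) := fun y => rfl
  have hnorm : ∀ y, ‖L (y - x)‖ = r⁻¹ * dist y x := fun y => by
    rw [hsub, norm_smul, Real.norm_of_nonneg (by positivity), dist_eq_norm]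
  refine ⟨fun y => (b ∘ L) (y - x), hbL.comp (contDiff_id.sub contDiff_const), ?_, ?_, ?_⟩
  · refine (closure_minimal (t := closedBall x (3 / 4 * r)) (fun y hy => ?_)
      isClosed_closedBall).trans (closedBall_subset_ball (by linarith))
    have hy' : L (y - x) ∈ Function.support b := hy
    rw [b.support_eq, mem_ball_zero_iff, hnorm] at hy'
    rw [mem_closedBall]
    have := mul_lt_mul_of_pos_left hy' hr
    rw [mul_inv_cancel_left₀ hr.ne'] at this
    change dist y x < r * (3 / 4) at this
    linarith
  · intro y hy
    refine b.one_of_mem_closedBall ?_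
    rw [mem_closedBall_zero_iff, hnorm]
    rw [mem_closedBall] at hy
    calc r⁻¹ * dist y x ≤ r⁻¹ * (r / 2) := by gcongr
      _ = 1 / 2 := by field_simp
  · intro j hj y
    rw [iteratedFDeriv_comp_sub (f := b ∘ L), L.iteratedFDeriv_comp_right hb (i := j) _
      (by exact_mod_cast hj)]
    refine (ContinuousMultilinearMap.norm_compContinuousLinearMap_le _ _).trans ?_
    have h1 : C j ≤ ∑ j ∈ Finset.range (k + 1), |C j| + 1 := by
      have := Finset.single_le_sum (f := fun j => |C j|) (fun i _ => abs_nonneg _)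
        (Finset.mem_range.2 (Nat.lt_succ_of_le hj))
      have := le_abs_self (C j)
      linarith
    rw [Finset.prod_const, Finset.card_univ, Fintype.card_fin]
    gcongr
    exact (hC j hj _).trans h1

/-- If the `k`-th derivative of `g` is at most `η` on `ball x r` and all lower derivatives vanish
at `x`, then the derivative of order `k - i` is at most `η * r ^ i` there. -/
theorem norm_iteratedFDeriv_le_of_jet_eq_zero {E F : Type*} [NormedAddCommGroup E]
    [NormedSpace ℝ E] [NormedAddCommGroup F] [NormedSpace ℝ F] {k : ℕ} {g : E → F} {x : E}
    {r η : ℝ} (hr : 0 < r) (hg : ∀ y ∈ ball x r, ContDiffAt ℝ k g y)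
    (h0 : ∀ j ≤ k, iteratedFDeriv ℝ j g x = 0)
    (hk : ∀ y ∈ ball x r, ‖iteratedFDeriv ℝ k g y‖ ≤ η) (i : ℕ) (hi : i ≤ k) :
    ∀ y ∈ ball x r, ‖iteratedFDeriv ℝ (k - i) g y‖ ≤ η * r ^ i := by
  have hη : 0 ≤ η := (norm_nonneg _).trans (hk x (mem_ball_self hr))
  induction i with
  | zero => simpa using hk
  | succ i ih =>
    intro y hy
    have hki : k - i = k - (i + 1) + 1 := by omega
    have h := Convex.norm_image_sub_le_of_norm_fderiv_le (𝕜 := ℝ)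
      (f := iteratedFDeriv ℝ (k - (i + 1)) g) (C := η * r ^ i) (s := ball x r) (x := x) (y := y)
      (fun z hz => (hg z hz).differentiableAt_iteratedFDeriv (by norm_cast; omega))
      (fun z hz => by
        rw [norm_fderiv_iteratedFDeriv, ← hki]
        exact ih (by omega) z hz)
      (convex_ball x r) (mem_ball_self hr) hy
    rw [h0 _ (Nat.sub_le _ _), sub_zero] at h
    refine h.trans ?_
    rw [pow_succ, ← mul_assoc]
    gcongr
    exact (mem_ball_iff_norm.1 hy).le

/-- A `C^k` function can be turned into a polynomial on a small ball by a correction which is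
small in `C^k` and supported in the ball of twice the radius. -/
theorem ContDiffOn.exists_local_correction {m k : ℕ} {f : (Fin m → ℝ) → ℝ} {G : Set (Fin m → ℝ)}
    (hf : ContDiffOn ℝ k f G) (hG : IsOpen G) {η : ℝ} (hη : 0 < η) {x : Fin m → ℝ} (hx : x ∈ G) :
    ∃ R > 0, ∀ r, 0 < r → r < R → closedBall x r ⊆ G ∧ ∃ w : (Fin m → ℝ) → ℝ,
      ContDiff ℝ k w ∧ tsupport w ⊆ closedBall x r ∧
      (∀ j ≤ k, ∀ y, ‖iteratedFDeriv ℝ j w y‖ ≤ η) ∧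
      ∃ p : MvPolynomial (Fin m) ℝ, p.totalDegree ≤ k ∧
        ∀ y ∈ closedBall x (r / 2), f y + w y = MvPolynomial.eval y p := by
  obtain ⟨C, hC0, hcut⟩ := exists_contDiff_cutoff m k
  have hfx : ∀ y ∈ G, ContDiffAt ℝ k f y := fun y hy => hf.contDiffAt (hG.mem_nhds hy)
  obtain ⟨p, hpd, hp⟩ := (hfx x hx).exists_taylor_mvPolynomial
  let P : (Fin m → ℝ) → ℝ := fun y => MvPolynomial.eval y p
  have hPc : ∀ y, ContDiffAt ℝ k P y := fun y => p.contDiff_eval.contDiffAt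
  have hgc : ∀ y ∈ G, ContDiffAt ℝ k (P - f) y := fun y hy => (hPc y).sub (hfx y hy)
  have hg0 : ∀ j ≤ k, iteratedFDeriv ℝ j (P - f) x = 0 := fun j hj => by
    have hj' : (j : WithTop ℕ∞) ≤ k := by exact_mod_cast hj
    rw [iteratedFDeriv_sub_apply ((hPc x).of_le hj') ((hfx x hx).of_le hj'), hp j hj, sub_self]
  set η' : ℝ := η / (2 ^ k * C) with hη'
  have hη'0 : 0 < η' := by positivity
  have hcont : ContinuousAt (iteratedFDeriv ℝ k (P - f)) x :=
    (hgc x hx).continuousAt_iteratedFDeriv le_rfl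
  have hev : ∀ᶠ y in nhds x, ‖iteratedFDeriv ℝ k (P - f) y‖ < η' := by
    refine hcont.norm.eventually_lt continuousAt_const ?_
    rw [hg0 k le_rfl, norm_zero]
    exact hη'0
  obtain ⟨R, hR0, hR⟩ := Metric.eventually_nhds_iff_ball.1 (hev.and (hG.mem_nhds hx))
  refine ⟨min R 1, by positivity, fun r hr hrR => ?_⟩
  have hrR' : r < R := hrR.trans_le (min_le_left _ _)
  have hr1 : r ≤ 1 := (hrR.trans_le (min_le_right _ _)).le
  have hsub : closedBall x r ⊆ G := fun y hy =>
    (hR y (closedBall_subset_ball hrR' hy)).2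
  refine ⟨hsub, ?_⟩
  obtain ⟨φ, hφc, hφs, hφ1, hφb⟩ := hcut x r hr
  have hball : ball x r ⊆ G := ball_subset_closedBall.trans hsub
  have hgb := norm_iteratedFDeriv_le_of_jet_eq_zero hr (fun y hy => hgc y (hball hy)) hg0
    (fun y hy => (hR y (ball_subset_ball hrR'.le hy)).1.le)
  have hws : tsupport (fun y => φ y * (P - f) y) ⊆ tsupport φ :=
    closure_mono fun y hy => left_ne_zero_of_mul hy
  refine ⟨fun y => φ y * (P - f) y, ?_, hws.trans (hφs.trans ball_subset_closedBall), ?_, p, hpd, ?_⟩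
  · rw [contDiff_iff_contDiffAt]
    intro y
    by_cases hy : y ∈ tsupport φ
    · exact hφc.contDiffAt.mul (hgc y (hball (hφs hy)))
    · exact (contDiffAt_const (c := (0 : ℝ))).congr_of_eventuallyEq
        (notMem_tsupport_iff_eventuallyEq.1 fun h => hy (hws h))
  · intro j hj y
    by_cases hy : y ∈ tsupport (fun y => φ y * (P - f) y)
    · have hyb : y ∈ ball x r := hφs (hws hy)
      have hmul := norm_iteratedFDerivWithin_mul_le (hφc.contDiffOn (s := ball x r))
        (fun z hz => (hgc z (hball hz)).contDiffWithinAt) isOpen_ball.uniqueDiffOn hyb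
        (n := j) (by exact_mod_cast hj)
      simp only [iteratedFDerivWithin_of_isOpen _ isOpen_ball hyb] at hmul
      refine hmul.trans ?_
      calc _ ≤ ∑ i ∈ Finset.range (j + 1), (j.choose i : ℝ) * (C * η') := by
            refine Finset.sum_le_sum fun i hi => ?_
            have hij : i ≤ j := Nat.lt_succ_iff.1 (Finset.mem_range.1 hi)
            have h1 := hφb i (hij.trans hj) y
            have h2 := hgb (k - (j - i)) (Nat.sub_le _ _) y hyb
            rw [Nat.sub_sub_self ((Nat.sub_le _ _).trans hj)] at h2
            rw [mul_assoc]
            refine mul_le_mul_of_nonneg_left ?_ (Nat.cast_nonneg _)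
            calc _ ≤ (C * r⁻¹ ^ i) * (η' * r ^ (k - (j - i))) := by gcongr
              _ = (C * η') * r ^ (k - j) := by
                have : k - (j - i) = (k - j) + i := by omega
                rw [this, pow_add, inv_pow]
                field_simp
              _ ≤ C * η' := mul_le_of_le_one_right (by positivity) (pow_le_one₀ hr.le hr1)
        _ = 2 ^ j * (C * η') := by
            rw [← Finset.sum_mul]
            congr 1
            exact_mod_cast Nat.sum_range_choose j
        _ ≤ 2 ^ k * (C * η') := by gcongr; norm_num
        _ = η := by rw [hη']; field_simp
    · have : iteratedFDeriv ℝ j (fun y => φ y * (P - f) y) y = 0 := by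
        by_contra h
        exact hy (support_iteratedFDeriv_subset j h)
      rw [this, norm_zero]
      exact hη.le
  · intro y hy
    simp [hφ1 y hy, P]

/-- One stage of the construction: a small compactly supported correction makes `f` polynomial on
finitely many disjoint balls that fill a fixed fraction of `G`. -/
theorem ContDiffOn.exists_correction_on_balls {m k : ℕ} {f : (Fin m → ℝ) → ℝ}
    {G : Set (Fin m → ℝ)} (hf : ContDiffOn ℝ k f G) (hG : IsOpen G) (hGfin : volume G ≠ ⊤)
    {δ : ℝ} (hδ : 0 < δ) :
    ∃ (w : (Fin m → ℝ) → ℝ) (t : Finset (Fin m → ℝ)) (ρ : (Fin m → ℝ) → ℝ),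
      ContDiff ℝ k w ∧ tsupport w ⊆ G ∧ (∀ j ≤ k, ∀ y, ‖iteratedFDeriv ℝ j w y‖ ≤ δ) ∧
      (∀ x ∈ t, 0 < ρ x ∧ closedBall x (ρ x) ⊆ G ∧
        ∃ p : MvPolynomial (Fin m) ℝ, p.totalDegree ≤ k ∧
          ∀ y ∈ closedBall x (ρ x), f y + w y = MvPolynomial.eval y p) ∧
      (t : Set (Fin m → ℝ)).PairwiseDisjoint (fun x => closedBall x (ρ x)) ∧
      volume.real (G \ ⋃ x ∈ t, closedBall x (ρ x)) ≤ (1 - (1 / 2) ^ (m + 1)) * volume.real G := by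
  classical
  choose! R hR0 hR using fun x (hx : x ∈ G) => hf.exists_local_correction hG hδ hx
  choose! hRG W hWc hWs hWb p hpd hp using hR
  obtain ⟨t, r, htc, htG, htr, htμ, htd⟩ := Besicovitch.exists_disjoint_closedBall_covering_ae
    (volume : Measure (Fin m → ℝ)) (fun _ => Ioi 0) G
    (fun x _ δ hδ => ⟨δ / 2, half_pos hδ, half_pos hδ, half_lt_self hδ⟩) R hR0
  have hr0 : ∀ x ∈ t, 0 < r x := fun x hx => (htr x hx).1
  have hrR : ∀ x ∈ t, r x < R x := fun x hx => (htr x hx).2.2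
  have hsubG : ∀ x ∈ t, closedBall x (r x) ⊆ G := fun x hx =>
    hRG x (htG hx) (r x) (hr0 x hx) (hrR x hx)
  obtain ⟨s, hst, hs⟩ : ∃ s : Finset (Fin m → ℝ), (s : Set (Fin m → ℝ)) ⊆ t ∧
      volume.real G / 2 ≤ ∑ x ∈ s, volume.real (closedBall x (r x)) := by
    by_cases hG0 : volume G = 0
    · exact ⟨∅, by simp, by simp [Measure.real, hG0]⟩
    have hsum : volume G ≤ ∑' x : t, volume (closedBall (x : Fin m → ℝ) (r x)) := by
      rw [← measure_biUnion htc htd fun x _ => measurableSet_closedBall]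
      exact measure_mono_ae (ae_le_set.2 htμ)
    have hlt : volume G / 2 < ∑' x : t, volume (closedBall (x : Fin m → ℝ) (r x)) :=
      (ENNReal.half_lt_self hG0 hGfin).trans_le hsum
    rw [ENNReal.tsum_eq_iSup_sum, lt_iSup_iff] at hlt
    obtain ⟨s, hs⟩ := hlt
    refine ⟨s.map (Function.Embedding.subtype _), by simp, ?_⟩
    rw [Finset.sum_map]
    have := ENNReal.toReal_mono (ENNReal.sum_ne_top.2 fun x _ => measure_closedBall_lt_top.ne) hs.le
    rw [ENNReal.toReal_sum fun x _ => measure_closedBall_lt_top.ne] at this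
    simpa [Measure.real] using this
  have hsd : (s : Set (Fin m → ℝ)).PairwiseDisjoint (fun x => closedBall x (r x)) :=
    htd.subset hst
  have hW : ∀ x ∈ s, ContDiff ℝ k (W x (r x)) ∧ tsupport (W x (r x)) ⊆ closedBall x (r x) ∧
      (∀ j ≤ k, ∀ y, ‖iteratedFDeriv ℝ j (W x (r x)) y‖ ≤ δ) := fun x hx =>
    have hx := hst hx
    ⟨hWc x (htG hx) _ (hr0 x hx) (hrR x hx), hWs x (htG hx) _ (hr0 x hx) (hrR x hx),
      hWb x (htG hx) _ (hr0 x hx) (hrR x hx)⟩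
  have hD0 : ∀ x ∈ s, ∀ y ∉ closedBall x (r x), ∀ j, iteratedFDeriv ℝ j (W x (r x)) y = 0 := by
    intro x hx y hy j
    by_contra h
    exact hy ((hW x hx).2.1 (support_iteratedFDeriv_subset j h))
  have hW0 : ∀ x ∈ s, ∀ y ∉ closedBall x (r x), W x (r x) y = 0 := fun x hx y hy =>
    image_eq_zero_of_notMem_tsupport fun h => hy ((hW x hx).2.1 h)
  have hother : ∀ x ∈ s, ∀ y ∈ closedBall x (r x), ∀ z ∈ s, z ≠ x → y ∉ closedBall z (r z) :=
    fun x hx y hy z hz hzx hyz => (hsd hz hx hzx).le_bot ⟨hyz, hy⟩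
  have hhalf : ∀ x ∈ s, closedBall x (r x / 2) ⊆ closedBall x (r x) := fun x hx =>
    closedBall_subset_closedBall (half_le_self (hr0 x (hst hx)).le)
  have hhd : (s : Set (Fin m → ℝ)).PairwiseDisjoint (fun x => closedBall x (r x / 2)) :=
    fun x hx y hy hxy => (hsd hx hy hxy).mono (hhalf x hx) (hhalf y hy)
  refine ⟨fun y => ∑ x ∈ s, W x (r x) y, s, fun x => r x / 2,
    ContDiff.sum fun x hx => (hW x hx).1, ?_, ?_, ?_, hhd, ?_⟩
  · refine (closure_minimal (t := ⋃ x ∈ s, closedBall x (r x)) (fun y hy => ?_)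
      (s.finite_toSet.isClosed_biUnion fun x _ => isClosed_closedBall)).trans
        (iUnion₂_subset fun x hx => hsubG x (hst hx))
    by_contra hy'
    simp only [mem_iUnion, not_exists] at hy'
    exact hy (Finset.sum_eq_zero fun x hx => hW0 x hx y (hy' x hx))
  · intro j hj y
    rw [iteratedFDeriv_sum fun x hx => (hW x hx).1.of_le (by exact_mod_cast hj), Finset.sum_apply]
    by_cases hy : ∃ x ∈ s, y ∈ closedBall x (r x)
    · obtain ⟨x, hx, hxy⟩ := hy
      rw [Finset.sum_eq_single_of_mem x hx fun z hz hzx =>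
        hD0 z hz y (hother x hx y hxy z hz hzx) j]
      exact (hW x hx).2.2 j hj y
    · push Not at hy
      rw [Finset.sum_eq_zero fun x hx => hD0 x hx y (hy x hx) j, norm_zero]
      exact hδ.le
  · intro x hx
    have hxt := hst hx
    refine ⟨half_pos (hr0 x hxt), (hhalf x hx).trans (hsubG x hxt), p x (r x),
      hpd x (htG hxt) _ (hr0 x hxt) (hrR x hxt), fun y hy => ?_⟩
    beta_reduce
    rw [Finset.sum_eq_single_of_mem x hx fun z hz hzx =>
        hW0 z hz y (hother x hx y (hhalf x hx hy) z hz hzx)]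
    exact hp x (htG hxt) _ (hr0 x hxt) (hrR x hxt) y hy
  · have hmeas : MeasurableSet (⋃ x ∈ s, closedBall x (r x / 2)) :=
      s.measurableSet_biUnion fun x _ => measurableSet_closedBall
    have hsub : (⋃ x ∈ s, closedBall x (r x / 2)) ⊆ G :=
      iUnion₂_subset fun x hx => (hhalf x hx).trans (hsubG x (hst hx))
    have hball : ∀ x ∈ s, volume.real (closedBall x (r x / 2)) =
        (1 / 2) ^ m * volume.real (closedBall x (r x)) := fun x hx => by
      have h0 := (hr0 x (hst hx)).le
      simp only [Measure.real, Measure.addHaar_closedBall volume x h0,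
        Measure.addHaar_closedBall volume x (div_nonneg h0 zero_le_two), ENNReal.toReal_mul,
        Module.finrank_fin_fun]
      rw [ENNReal.toReal_ofReal (by positivity), ENNReal.toReal_ofReal (by positivity), div_pow,
        div_pow, one_pow]
      ring
    have hU : volume.real (⋃ x ∈ s, closedBall x (r x / 2)) =
        (1 / 2) ^ m * ∑ x ∈ s, volume.real (closedBall x (r x)) := by
      rw [measureReal_biUnion_finset hhd (fun x _ => measurableSet_closedBall)
        (fun x _ => measure_closedBall_lt_top.ne), Finset.sum_congr rfl hball, Finset.mul_sum]
    rw [measureReal_sdiff hsub hmeas hGfin, hU]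
    have := mul_le_mul_of_nonneg_left hs (show (0 : ℝ) ≤ (1 / 2) ^ m by positivity)
    rw [pow_succ]
    linarith

theorem piecewisePolyOn_of_countable {m d : ℕ} {Ω : Set (Fin m → ℝ)} {f : (Fin m → ℝ) → ℝ}
    {ι : Type*} [Countable ι] (U : ι → Set (Fin m → ℝ)) (hUo : ∀ i, IsOpen (U i))
    (hUΩ : ∀ i, U i ⊆ Ω) (hUd : Pairwise fun i j => Disjoint (U i) (U j))
    (hUμ : volume (Ω \ ⋃ i, U i) = 0)
    (hUp : ∀ i, ∃ p : MvPolynomial (Fin m) ℝ, p.totalDegree ≤ d ∧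
      ∀ x ∈ U i, f x = MvPolynomial.eval x p) :
    PiecewisePolyOn d Ω f := by
  have := Encodable.ofCountable ι
  refine ⟨fun n => ⋃ i ∈ Encodable.decode₂ ι n, U i,
    fun n => isOpen_iUnion fun i => isOpen_iUnion fun _ => hUo i,
    fun n => iUnion₂_subset fun i _ => hUΩ i, Encodable.iUnion_decode₂_disjoint_on hUd, ?_,
    fun n => ?_⟩
  · rwa [Encodable.iUnion_decode₂]
  · cases h : Encodable.decode₂ ι n with
    | none => exact ⟨0, by simp, fun x hx => by simp [h] at hx⟩
    | some i =>
      obtain ⟨p, hpd, hp⟩ := hUp i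
      exact ⟨p, hpd, fun x hx => hp x (by simpa [h] using hx)⟩

/-- A `C^k` function on an open set of finite measure becomes piecewise polynomial of degree `k`
after adding a small `C^k` function that vanishes to order `k` outside the set. -/
theorem ContDiffOn.exists_piecewisePolyOn_add {m k : ℕ} {Ω : Set (Fin m → ℝ)}
    {u : (Fin m → ℝ) → ℝ} (hu : ContDiffOn ℝ k u Ω) (hΩo : IsOpen Ω) (hΩ : volume Ω ≠ ⊤)
    {ε : ℝ} (hε : 0 < ε) :
    ∃ w : (Fin m → ℝ) → ℝ, ContDiff ℝ k w ∧ (∀ j ≤ k, ∀ y, ‖iteratedFDeriv ℝ j w y‖ ≤ ε) ∧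
      (∀ j ≤ k, ∀ y ∉ Ω, iteratedFDeriv ℝ j w y = 0) ∧ PiecewisePolyOn k Ω (u + w) := by
  let S := {s : Set (Fin m → ℝ) × ((Fin m → ℝ) → ℝ) //
    IsOpen s.1 ∧ volume s.1 ≠ ⊤ ∧ ContDiffOn ℝ k s.2 s.1}
  have hδ : ∀ n : ℕ, 0 < ε / 2 / 2 ^ n := fun n => by positivity
  choose W T P hWc hWs hWb hT hTd hTμ using fun (n : ℕ) (s : S) =>
    s.2.2.2.exists_correction_on_balls s.2.1 s.2.2.1 (hδ n)
  let next : ℕ → S → S := fun n s =>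
    ⟨(s.1.1 \ ⋃ x ∈ T n s, closedBall x (P n s x), s.1.2 + W n s),
      s.2.1.sdiff ((T n s).finite_toSet.isClosed_biUnion fun _ _ => isClosed_closedBall),
      measure_ne_top_of_subset sdiff_subset s.2.2.1,
      (s.2.2.2.add (hWc n s).contDiffOn).mono sdiff_subset⟩
  let seq : ℕ → S := fun n => Nat.rec ⟨(Ω, u), hΩo, hΩ, hu⟩ next n
  let G : ℕ → Set (Fin m → ℝ) := fun n => (seq n).1.1
  let f : ℕ → (Fin m → ℝ) → ℝ := fun n => (seq n).1.2
  let w : ℕ → (Fin m → ℝ) → ℝ := fun n => W n (seq n)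
  let t : ℕ → Finset (Fin m → ℝ) := fun n => T n (seq n)
  let ρ : ℕ → (Fin m → ℝ) → ℝ := fun n => P n (seq n)
  have hGsucc : ∀ n, G (n + 1) = G n \ ⋃ x ∈ t n, closedBall x (ρ n x) := fun _ => rfl
  have hGanti : Antitone G := antitone_nat_of_succ_le fun n => by
    rw [hGsucc]
    exact sdiff_subset
  have hGΩ : ∀ n, G n ⊆ Ω := fun n => hGanti (Nat.zero_le n)
  have hfsum : ∀ n y, f n y = u y + ∑ i ∈ Finset.range n, w i y := by
    intro n y
    induction n with
    | zero => simp [f, seq]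
    | succ n ih =>
      rw [Finset.sum_range_succ, ← add_assoc, ← ih]
      rfl
  have hwG : ∀ n, ∀ y ∉ G n, ∀ j, iteratedFDeriv ℝ j (w n) y = 0 := by
    intro n y hy j
    by_contra h
    exact hy (hWs n (seq n) (support_iteratedFDeriv_subset j h))
  have hw0 : ∀ n, ∀ y ∉ G n, w n y = 0 := fun n y hy =>
    image_eq_zero_of_notMem_tsupport fun h => hy (hWs n (seq n) h)
  have hsum : HasSum (fun n : ℕ => ε / 2 / 2 ^ n) ε := hasSum_geometric_two' ε
  have hwc : ∀ n, ContDiff ℝ ((k : ℕ∞) : WithTop ℕ∞) (w n) := fun n => hWc n (seq n)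
  have hwb : ∀ (j n : ℕ) (y : Fin m → ℝ), (j : ℕ∞) ≤ (k : ℕ∞) →
      ‖iteratedFDeriv ℝ j (w n) y‖ ≤ ε / 2 / 2 ^ n := fun j n y hj =>
    hWb n (seq n) j (by exact_mod_cast hj) y
  have hiter : ∀ j ≤ k, ∀ y, iteratedFDeriv ℝ j (fun y => ∑' n, w n y) y =
      ∑' n, iteratedFDeriv ℝ j (w n) y := fun j hj y =>
    iteratedFDeriv_tsum_apply hwc (fun _ _ => hsum.summable) hwb (by exact_mod_cast hj) y
  have hpoly : ∀ n, ∀ x ∈ t n, ∃ p : MvPolynomial (Fin m) ℝ, p.totalDegree ≤ k ∧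
      ∀ y ∈ closedBall x (ρ n x), u y + ∑' n, w n y = MvPolynomial.eval y p := by
    intro n x hx
    obtain ⟨p, hpd, hp⟩ := (hT n (seq n) x hx).2.2
    refine ⟨p, hpd, fun y hy => ?_⟩
    have hyG : y ∉ G (n + 1) := fun h => h.2 (mem_biUnion hx hy)
    rw [tsum_eq_sum (s := Finset.range (n + 1)) fun i hi => hw0 i y fun h =>
      hyG (hGanti (Nat.succ_le_of_lt (by simpa using hi)) h), ← hfsum]
    exact hp y hy
  have hGμ : ∀ n, volume.real (G n) ≤ (1 - (1 / 2) ^ (m + 1)) ^ n * volume.real Ω := by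
    have hc : (0 : ℝ) ≤ 1 - (1 / 2) ^ (m + 1) :=
      sub_nonneg.2 (pow_le_one₀ (by norm_num) (by norm_num))
    intro n
    induction n with
    | zero => simp [G, seq]
    | succ n ih =>
      refine (hTμ n (seq n)).trans ?_
      rw [pow_succ' (1 - (1 / 2) ^ (m + 1) : ℝ) n, mul_assoc]
      exact mul_le_mul_of_nonneg_left ih hc
  have hGinter : volume (⋂ n, G n) = 0 := by
    have htend : Tendsto (fun n : ℕ => (1 - (1 / 2) ^ (m + 1) : ℝ) ^ n * volume.real Ω)
        atTop (nhds 0) := by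
      have := (tendsto_pow_atTop_nhds_zero_of_lt_one (r := (1 - (1 / 2) ^ (m + 1) : ℝ))
        (sub_nonneg.2 (pow_le_one₀ (by norm_num) (by norm_num)))
        (sub_lt_self _ (by positivity))).mul_const (volume.real Ω)
      rwa [zero_mul] at this
    have hle : volume.real (⋂ n, G n) ≤ 0 := ge_of_tendsto' htend fun n =>
      (measureReal_mono (iInter_subset G n) (seq n).2.2.1).trans (hGμ n)
    refine (measureReal_eq_zero_iff (measure_ne_top_of_subset (iInter_subset G 0) hΩ)).1 ?_
    exact le_antisymm hle measureReal_nonneg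
  have hballG : ∀ n, ∀ x ∈ t n, closedBall x (ρ n x) ⊆ G n := fun n x hx => (hT n (seq n) x hx).2.1
  have hρ : ∀ n, ∀ x ∈ t n, 0 < ρ n x := fun n x hx => (hT n (seq n) x hx).1
  have hlt : ∀ i j, i < j → ∀ x ∈ t i, ∀ z ∈ t j,
      Disjoint (ball x (ρ i x)) (ball z (ρ j z)) := by
    intro i j hij x hx z hz
    refine disjoint_left.2 fun y hy hy' => ?_
    have : y ∈ G (i + 1) := hGanti hij (hballG j z hz (ball_subset_closedBall hy'))
    exact this.2 (mem_biUnion hx (ball_subset_closedBall hy))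
  refine ⟨fun y => ∑' n, w n y, contDiff_tsum hwc (fun _ _ => hsum.summable) hwb, ?_, ?_, ?_⟩
  · intro j hj y
    rw [hiter j hj y]
    exact tsum_of_norm_bounded hsum fun n => hwb j n y (by exact_mod_cast hj)
  · intro j hj y hy
    rw [hiter j hj y]
    have : ∀ n, iteratedFDeriv ℝ j (w n) y = 0 := fun n => hwG n y (fun h => hy (hGΩ n h)) j
    simp [this]
  · refine piecewisePolyOn_of_countable
      (fun i : Σ n, {x // x ∈ t n} => ball (i.2 : Fin m → ℝ) (ρ i.1 i.2)) (fun i => isOpen_ball)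
      (fun i => ball_subset_closedBall.trans ((hballG i.1 _ i.2.2).trans (hGΩ _))) ?_ ?_ ?_
    · rintro ⟨i, x, hx⟩ ⟨j, z, hz⟩ hne
      rcases lt_trichotomy i j with hij | rfl | hij
      · exact hlt i j hij x hx z hz
      · have hxz : x ≠ z := fun h => hne (by subst h; rfl)
        exact (hTd i (seq i) hx hz hxz).mono ball_subset_closedBall ball_subset_closedBall
      · exact (hlt j i hij z hz x hx).symm
    · have hsub : (Ω \ ⋃ i : Σ n, {x // x ∈ t n}, ball (i.2 : Fin m → ℝ) (ρ i.1 i.2)) ⊆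
          (⋂ n, G n) ∪ ⋃ i : Σ n, {x // x ∈ t n}, sphere (i.2 : Fin m → ℝ) (ρ i.1 i.2) := by
        rintro y ⟨hyΩ, hy⟩
        simp only [mem_iUnion, not_exists] at hy
        by_contra hcon
        simp only [mem_union, mem_iUnion, not_or, not_exists] at hcon
        refine hcon.1 (mem_iInter.2 fun n => ?_)
        induction n with
        | zero => exact hyΩ
        | succ n ih =>
          refine ⟨ih, fun h => ?_⟩
          obtain ⟨x, hx, hxy⟩ := mem_iUnion₂.1 h
          rw [← ball_union_sphere] at hxy
          exact hxy.elim (hy ⟨n, x, hx⟩) (hcon.2 ⟨n, x, hx⟩)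
      refine measure_mono_null hsub (measure_union_null hGinter (measure_iUnion_null fun i => ?_))
      exact Measure.addHaar_sphere_of_ne_zero _ _ (hρ i.1 _ i.2.2).ne'
    · rintro ⟨n, x, hx⟩
      obtain ⟨p, hpd, hp⟩ := hpoly n x hx
      exact ⟨p, hpd, fun y hy => hp y (ball_subset_closedBall hy)⟩

/-- No uniqueness of derivatives within `s` is assumed: `f + g` and `f` have the same derivatives
within `s` at `x`, so the chosen ones coincide. -/
theorem fderivWithin_add_of_hasFDerivAt_zero {E F : Type*} [NormedAddCommGroup E]
    [NormedSpace ℝ E] [NormedAddCommGroup F] [NormedSpace ℝ F] {f g : E → F} {s : Set E} {x : E}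
    (hg : HasFDerivAt g (0 : E →L[ℝ] F) x) :
    fderivWithin ℝ (f + g) s x = fderivWithin ℝ f s x := by
  have h : (fun f' : E →L[ℝ] F => HasFDerivWithinAt (f + g) f' s x) =
      fun f' => HasFDerivWithinAt f f' s x := by
    funext f'
    refine propext ⟨fun h => ?_, fun h => ?_⟩
    · simpa using h.sub hg.hasFDerivWithinAt
    · simpa using h.add hg.hasFDerivWithinAt
  classical
  have key : ∀ P Q : (E →L[ℝ] F) → Prop, P = Q →
      (if P 0 then 0 else if h : ∃ f', P f' then Classical.choose h else 0) =
        if Q 0 then 0 else if h : ∃ f', Q f' then Classical.choose h else 0 := by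
    rintro _ _ rfl
    rfl
  simp only [fderivWithin, DifferentiableWithinAt]
  exact key _ _ h

theorem iteratedFDerivWithin_closure_add {m k : ℕ} {Ω : Set (Fin m → ℝ)} (hΩ : IsOpen Ω)
    {u w : (Fin m → ℝ) → ℝ} (hu : ContDiffOn ℝ k u Ω) (hw : ContDiff ℝ k w)
    (hw0 : ∀ j ≤ k, ∀ y ∉ Ω, iteratedFDeriv ℝ j w y = 0) (j : ℕ) (hj : j ≤ k) :
    ∀ x ∈ closure Ω, iteratedFDerivWithin ℝ j (u + w) (closure Ω) x =
      iteratedFDerivWithin ℝ j u (closure Ω) x + iteratedFDeriv ℝ j w x := by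
  induction j with
  | zero =>
    intro x _
    ext v
    simp
  | succ j ih =>
    intro x hx
    by_cases hxΩ : x ∈ Ω
    · have hset : closure Ω =ᶠ[nhds x] univ :=
        eventuallyEq_univ.2 (mem_of_superset (hΩ.mem_nhds hxΩ) subset_closure)
      have hj' : ((j + 1 : ℕ) : WithTop ℕ∞) ≤ k := by exact_mod_cast hj
      rw [iteratedFDerivWithin_congr_set hset, iteratedFDerivWithin_congr_set hset,
        iteratedFDerivWithin_univ, iteratedFDerivWithin_univ]
      exact iteratedFDeriv_add_apply ((hu.contDiffAt (hΩ.mem_nhds hxΩ)).of_le hj')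
        (hw.contDiffAt.of_le hj')
    · have hderiv : HasFDerivAt (iteratedFDeriv ℝ j w)
          (0 : (Fin m → ℝ) →L[ℝ] (Fin m → ℝ) [×j]→L[ℝ] ℝ) x := by
        have hd := (hw.contDiffAt (x := x)).differentiableAt_iteratedFDeriv (m := j)
          (by exact_mod_cast hj)
        have h0 : fderiv ℝ (iteratedFDeriv ℝ j w) x = 0 := by
          rw [fderiv_iteratedFDeriv, Function.comp_apply, hw0 _ hj x hxΩ]
          exact LinearIsometryEquiv.map_zero _
        rw [← h0]
        exact hd.hasFDerivAt
      rw [hw0 _ hj x hxΩ, add_zero, iteratedFDerivWithin_succ_eq_comp_left,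
        iteratedFDerivWithin_succ_eq_comp_left, Function.comp_apply, Function.comp_apply,
        fderivWithin_congr (f := iteratedFDerivWithin ℝ j u (closure Ω) + iteratedFDeriv ℝ j w)
          (fun y hy => ih (by omega) y hy) (ih (by omega) x hx),
        fderivWithin_add_of_hasFDerivAt_zero hderiv]

/-- **Piecewise-polynomial approximation in `C^{k'}`.** Any `u ∈ C^{k'}(Ω̄)` can be approximated
in the `C^{k'}(Ω̄)` norm by functions that are piecewise polynomials of degree `k'` and agree with
`u`, together with all derivatives of order `≤ k'`, on `∂Ω`. -/
theorem piecewise_polynomial_approximation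
    {m k' : ℕ}
    (Ω : Set (Fin m → ℝ)) (hΩo : IsOpen Ω) (hΩb : Bornology.IsBounded Ω)
    (u : (Fin m → ℝ) → ℝ) (hu : ContDiffOn ℝ (k' : ℕ∞) u (closure Ω))
    (ε : ℝ) (hε : 0 < ε) :
    ∃ v : (Fin m → ℝ) → ℝ,
      ContDiffOn ℝ (k' : ℕ∞) v (closure Ω) ∧
      (∀ j ≤ k', ∀ x ∈ closure Ω,
        ‖iteratedFDerivWithin ℝ j u (closure Ω) x -
          iteratedFDerivWithin ℝ j v (closure Ω) x‖ ≤ ε) ∧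
      PiecewisePolyOn k' Ω v ∧
      (∀ j ≤ k', ∀ x ∈ frontier Ω,
        iteratedFDerivWithin ℝ j v (closure Ω) x =
          iteratedFDerivWithin ℝ j u (closure Ω) x) := by
  have huΩ : ContDiffOn ℝ k' u Ω := hu.mono subset_closure
  obtain ⟨w, hwc, hwb, hw0, hpw⟩ :=
    huΩ.exists_piecewisePolyOn_add hΩo hΩb.measure_lt_top.ne hε
  have hadd := iteratedFDerivWithin_closure_add hΩo huΩ hwc hw0
  refine ⟨u + w, hu.add hwc.contDiffOn, fun j hj x hx => ?_, hpw, fun j hj x hx => ?_⟩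
  · rw [hadd j hj x hx, sub_add_cancel_left, norm_neg]
    exact hwb j hj x
  · rw [hadd j hj x (frontier_subset_closure hx), hw0 j hj x, add_zero]
    exact fun h => hx.2 (hΩo.interior_eq.symm ▸ h)
end

section
/- Let q_1, q_2, q_3 be the unique homogeneous polynomials of degree 11 in two variables determined by the interpolation conditions in the context, let 𝔹(ξ) = (q_1(ξ), q_2(ξ), q_3(ξ))ᵀ, and let 𝔸(ξ) be the 3×3 matrix with rows (0, −q_3(ξ), q_2(ξ)), (−q_3(ξ), 0, q_1(ξ)), (−q_2(ξ), q_1(ξ), 0). Then: (i) for all 1 ≤ i < j ≤ 4, a_i − a_j ∉ Λ_𝒜 = ⋃_{ξ ∈ ℝ²∖{0}} ker 𝔸(ξ); (ii) for every ξ ∈ ℝ²∖{0}, rank 𝔸(ξ) = 2 and ker 𝔸(ξ) = im 𝔹(ξ) = span{(q_1(ξ), q_2(ξ), q_3(ξ))} (so 𝒜 has constant rank and 𝓑 is a potential for 𝒜); (iii) span(Λ_𝒜) = ℝ³ (so 𝒜 is balanced). -/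
open MeasureTheory Metric Set Matrix Filter

/-- The four states `a_1 = 0`, `a_2 = e_1`, `a_3 = e_2`, `a_4 = e_3` in `ℝ³`. -/
def aPt : Fin 4 → (Fin 3 → ℝ) := ![![0,0,0], ![1,0,0], ![0,1,0], ![0,0,1]]

/-- The permutations `σ₁ = (1,2,3,4)`, `σ₂ = (4,1,2,3)`, `σ₃ = (3,4,1,2)` (zero-indexed). -/
def sigmaP : Fin 3 → Fin 4 → Fin 4 := ![![0,1,2,3], ![3,0,1,2], ![2,3,0,1]]

/-- The inverse permutations of `sigmaP`. -/
def sigmaInv : Fin 3 → Fin 4 → Fin 4 := ![![0,1,2,3], ![1,2,3,0], ![2,3,0,1]]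

/-- The base points `p^{σ_i}`. -/
noncomputable def pVal : Fin 3 → (Fin 3 → ℝ) :=
  ![![2/15, 4/15, 8/15], ![18/65, 27/65, 8/65], ![64/175, 27/175, 36/175]]

/-- The vectors `c^{σ_i}_ℓ`. -/
noncomputable def cVal : Fin 3 → Fin 4 → (Fin 3 → ℝ) :=
  ![![![-1/15, -2/15, -4/15], ![7/15, -1/15, -2/15],
      ![-4/15, 7/15, -1/15], ![-2/15, -4/15, 7/15]],
    ![![-6/65, -9/65, 19/65], ![-4/65, -6/65, -9/65],
      ![19/65, -4/65, -6/65], ![-9/65, 19/65, -4/65]],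
    ![![-16/175, 37/175, -9/175], ![-12/175, -16/175, 37/175],
      ![-9/175, -12/175, -16/175], ![37/175, -9/175, -12/175]]]

/-- The coefficients `k^{σ_i}_ℓ = i + 1` (`= 2, 3, 4` for `i = 1, 2, 3`). -/
def kVal : Fin 3 → ℝ := ![2, 3, 4]

/-- The interpolation points `(ξ^{σ_i}_{2ℓ-1}, ξ^{σ_i}_{2ℓ}) ∈ ℝ²`. -/
def xiVal : Fin 3 → Fin 4 → (Fin 2 → ℝ) :=
  ![![![-14, 5], ![19, -8], ![11, -14], ![-4, -17]],
    ![![-7, -3], ![6, 16], ![2, -17], ![-18, 2]],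
    ![![-7, -14], ![-9, 19], ![6, 18], ![-20, -9]]]

/-- The 36 interpolation conditions (together with homogeneity of degree 11) that determine
the polynomials `q₁, q₂, q₃`. -/
def InterpCond (q : Fin 3 → MvPolynomial (Fin 2) ℝ) : Prop :=
  (∀ j : Fin 3, (q j).IsHomogeneous 11) ∧
  ∀ (i : Fin 3) (ℓ : Fin 4) (j : Fin 3),
    MvPolynomial.eval (xiVal i ℓ) (q j) = cVal i ℓ j

/-- The symbol `𝔸(ξ)` of the operator `𝒜`, built from `q₁, q₂, q₃`. -/
noncomputable def AMat (q : Fin 3 → MvPolynomial (Fin 2) ℝ) (ξ : Fin 2 → ℝ) :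
    Matrix (Fin 3) (Fin 3) ℝ :=
  !![0, -(MvPolynomial.eval ξ (q 2)), MvPolynomial.eval ξ (q 1);
     -(MvPolynomial.eval ξ (q 2)), 0, MvPolynomial.eval ξ (q 0);
     -(MvPolynomial.eval ξ (q 1)), MvPolynomial.eval ξ (q 0), 0]

/-- The wave cone `Λ_𝒜 = ⋃_{ξ ≠ 0} ker 𝔸(ξ)` of the explicit operator. -/
def LamA (q : Fin 3 → MvPolynomial (Fin 2) ℝ) : Set (Fin 3 → ℝ) :=
  {η | ∃ ξ : Fin 2 → ℝ, ξ ≠ 0 ∧ (AMat q ξ).mulVec η = 0}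

/-- The Bezout matrix of the binary forms `∑ k ≤ n, f k x ^ k y ^ (n - k)` and
`∑ k ≤ n, g k x ^ k y ^ (n - k)`. -/
def bezoutMatrix {R : Type*} [CommRing R] (n : ℕ) (f g : ℕ → R) : Matrix (Fin n) (Fin n) R :=
  fun i j => ∑ b ∈ Finset.range (i + 1),
    if b ≤ j then f (i + 1 + (j - b)) * g b - g (i + 1 + (j - b)) * f b else 0

/-- The value at `(x, y)` of the binary form of degree `n` with coefficients `f`. -/
def binaryForm {R : Type*} [CommRing R] (n : ℕ) (f : ℕ → R) (x y : R) : R :=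
  ∑ k ∈ Finset.range (n + 1), f k * (x ^ k * y ^ (n - k))

theorem sum_shifted_monomials {R : Type*} [CommRing R] {n : ℕ} {f : ℕ → R}
    (hf : ∀ k, n < k → f k = 0) (x y : R) {i b : ℕ} (hi : i < n) (hb : b ≤ i) :
    ∑ j ∈ Finset.range n, (if b ≤ j then f (i + 1 + (j - b)) else 0) * (x ^ j * y ^ (n - 1 - j)) =
      (∑ a ∈ Finset.range (n - i), f (i + 1 + a) * (x ^ a * y ^ (n - 1 - i - a))) *
        (x ^ b * y ^ (i - b)) := by
  obtain ⟨m, rfl⟩ := Nat.exists_eq_add_of_lt hi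
  obtain ⟨d, rfl⟩ := Nat.exists_eq_add_of_le hb
  rw [show b + d + m + 1 = b + ((m + 1) + d) by omega, Finset.sum_range_add,
    Finset.sum_range_add, Finset.sum_eq_zero, Finset.sum_eq_zero (s := Finset.range d),
    show b + (m + 1 + d) - (b + d) = m + 1 by omega, Finset.sum_mul, zero_add, add_zero]
  · refine Finset.sum_congr rfl fun a ha => ?_
    have ha' : a ≤ m := by simpa [Nat.lt_succ_iff] using ha
    obtain ⟨c, rfl⟩ := Nat.exists_eq_add_of_le ha'
    rw [if_pos (by omega), show b + a - b = a by omega,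
      show b + (a + c + 1 + d) - 1 - (b + a) = c + d by omega,
      show b + (a + c + 1 + d) - 1 - (b + d) - a = c by omega,
      show b + d - b = d by omega]
    ring
  · intro a _
    rw [if_pos (by omega), hf _ (by omega), zero_mul]
  · intro j hj
    rw [if_neg (by simpa using hj), zero_mul]

theorem binaryForm_split {R : Type*} [CommRing R] {n : ℕ} (f : ℕ → R) (x y : R) {i : ℕ}
    (hi : i < n) :
    binaryForm n f x y =
      y ^ (n - i) * (∑ b ∈ Finset.range (i + 1), f b * (x ^ b * y ^ (i - b))) +
      x ^ (i + 1) *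
        ∑ a ∈ Finset.range (n - i), f (i + 1 + a) * (x ^ a * y ^ (n - 1 - i - a)) := by
  rw [binaryForm, show n + 1 = (i + 1) + (n - i) by omega, Finset.sum_range_add, Finset.mul_sum,
    Finset.mul_sum]
  congr 1
  · refine Finset.sum_congr rfl fun b hb => ?_
    have : b ≤ i := by simpa [Nat.lt_succ_iff] using hb
    rw [show n - b = (n - i) + (i - b) by omega]
    ring
  · refine Finset.sum_congr rfl fun a _ => ?_
    rw [show n - (i + 1 + a) = n - 1 - i - a by omega]
    ring

theorem bezoutMatrix_mulVec_monomials {K : Type*} [Field K] {n : ℕ} {f g : ℕ → K}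
    (hf : ∀ k, n < k → f k = 0) (hg : ∀ k, n < k → g k = 0) {x y : K} (hxy : x ≠ 0 ∨ y ≠ 0)
    (hfx : binaryForm n f x y = 0) (hgx : binaryForm n g x y = 0) :
    (bezoutMatrix n f g).mulVec (fun j => x ^ (j : ℕ) * y ^ (n - 1 - j)) = 0 := by
  ext i
  have hi := i.isLt
  rw [binaryForm_split f x y hi] at hfx
  rw [binaryForm_split g x y hi] at hgx
  have expand : (bezoutMatrix n f g).mulVec (fun j => x ^ (j : ℕ) * y ^ (n - 1 - j)) i =
      (∑ a ∈ Finset.range (n - i), f (i + 1 + a) * (x ^ a * y ^ (n - 1 - i - a))) *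
        (∑ b ∈ Finset.range (i + 1), g b * (x ^ b * y ^ (i - b))) -
      (∑ a ∈ Finset.range (n - i), g (i + 1 + a) * (x ^ a * y ^ (n - 1 - i - a))) *
        (∑ b ∈ Finset.range (i + 1), f b * (x ^ b * y ^ (i - b))) := by
    rw [Finset.mul_sum, Finset.mul_sum, ← Finset.sum_sub_distrib]
    simp only [Matrix.mulVec, dotProduct, bezoutMatrix]
    rw [Fin.sum_univ_eq_sum_range (fun j => (∑ b ∈ Finset.range (i + 1),
      if b ≤ j then f (i + 1 + (j - b)) * g b - g (i + 1 + (j - b)) * f b else 0) *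
        (x ^ j * y ^ (n - 1 - j))) n]
    simp only [Finset.sum_mul (s := Finset.range (i + 1))]
    rw [Finset.sum_comm]
    refine Finset.sum_congr rfl fun b hb => ?_
    have hb' : b ≤ i := by simpa [Nat.lt_succ_iff] using hb
    rw [mul_left_comm, ← sum_shifted_monomials hf x y hi hb', mul_left_comm (_ : K) (f b),
      ← sum_shifted_monomials hg x y hi hb', Finset.mul_sum, Finset.mul_sum,
      ← Finset.sum_sub_distrib]
    refine Finset.sum_congr rfl fun j _ => ?_
    split_ifs <;> ring
  rw [expand, Pi.zero_apply]
  rcases hxy with hx | hy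
  · refine (mul_eq_zero.mp ?_).resolve_left (pow_ne_zero (i + 1) hx)
    linear_combination (∑ b ∈ Finset.range (i + 1), g b * (x ^ b * y ^ (i - b))) * hfx -
      (∑ b ∈ Finset.range (i + 1), f b * (x ^ b * y ^ (i - b))) * hgx
  · refine (mul_eq_zero.mp ?_).resolve_left (pow_ne_zero (n - i) hy)
    linear_combination
      (∑ a ∈ Finset.range (n - i), f (i + 1 + a) * (x ^ a * y ^ (n - 1 - i - a))) * hgx -
      (∑ a ∈ Finset.range (n - i), g (i + 1 + a) * (x ^ a * y ^ (n - 1 - i - a))) * hfx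

theorem det_ne_zero_of_mul_modEq_one {ι : Type*} [Fintype ι] [DecidableEq ι] {p : ℕ}
    (hp : 1 < p) {M N : Matrix ι ι ℤ}
    (h : ∀ i j, (N * M) i j ≡ (1 : Matrix ι ι ℤ) i j [ZMOD p]) : M.det ≠ 0 := by
  intro h0
  have : Fact (1 < p) := ⟨hp⟩
  have key : (N * M).map (Int.castRingHom (ZMod p)) = 1 := by
    ext i j
    have := (ZMod.intCast_eq_intCast_iff _ _ _).mpr (h i j)
    simpa [Matrix.one_apply, apply_ite] using this
  have hdet := congrArg Matrix.det key
  rw [← RingHom.mapMatrix_apply, ← RingHom.map_det, Matrix.det_mul, h0] at hdet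
  simp at hdet

/-- Two integral binary forms whose Bezout matrix is invertible modulo `p` have no common zero
on the projective line. -/
theorem no_common_zero {K : Type*} [Field K] [CharZero K] {n p : ℕ} (hp : 1 < p)
    {f g : ℕ → ℤ} (hf : ∀ k, n < k → f k = 0)
    (hg : ∀ k, n < k → g k = 0) (N : Matrix (Fin n) (Fin n) ℤ) (hn : 0 < n)
    (h : ∀ i j, (N * bezoutMatrix n f g) i j ≡ (1 : Matrix (Fin n) (Fin n) ℤ) i j [ZMOD p])
    {x y : K} (hxy : x ≠ 0 ∨ y ≠ 0) (hfx : binaryForm n (fun k => (f k : K)) x y = 0) :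
    binaryForm n (fun k => (g k : K)) x y ≠ 0 := by
  intro hgx
  refine det_ne_zero_of_mul_modEq_one hp h ?_
  have hmap : (bezoutMatrix n f g).map (Int.castRingHom K) =
      bezoutMatrix n (fun k => (f k : K)) (fun k => (g k : K)) := by
    ext i j
    simp [bezoutMatrix, apply_ite]
  have hdet : ((bezoutMatrix n f g).map (Int.castRingHom K)).det = 0 := by
    rw [hmap]
    refine Matrix.exists_mulVec_eq_zero_iff.mp ⟨_, fun h0 => ?_,
      bezoutMatrix_mulVec_monomials (fun k hk => by simp [hf k hk])
        (fun k hk => by simp [hg k hk]) hxy hfx hgx⟩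
    rcases hxy with hx | hy
    · have := congrFun h0 ⟨n - 1, by omega⟩
      simp [hx] at this
    · have := congrFun h0 ⟨0, hn⟩
      simp [hy] at this
  rw [← RingHom.mapMatrix_apply, ← RingHom.map_det] at hdet
  simpa using hdet

theorem eval_eq_binaryForm_of_isHomogeneous {R : Type*} [CommRing R] {n : ℕ}
    {p : MvPolynomial (Fin 2) R} (hp : p.IsHomogeneous n) :
    ∃ a : ℕ → R, ∀ ξ : Fin 2 → R, MvPolynomial.eval ξ p = binaryForm n a (ξ 0) (ξ 1) := by
  let e : ℕ → (Fin 2 →₀ ℕ) := fun k => Finsupp.single 0 k + Finsupp.single 1 (n - k)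
  have he0 : ∀ k, e k 0 = k := fun k => by simp [e]
  have he1 : ∀ k, e k 1 = n - k := fun k => by simp [e]
  refine ⟨fun k => p.coeff (e k), fun ξ => ?_⟩
  have hsub : p.support ⊆ (Finset.range (n + 1)).image e := by
    intro d hd
    have hdeg := hp (MvPolynomial.mem_support_iff.mp hd)
    simp only [Finsupp.weight_apply, Finsupp.sum_fintype, Fin.sum_univ_two, Pi.one_apply,
      smul_eq_mul, mul_one, implies_true] at hdeg
    refine Finset.mem_image.mpr ⟨d 0, Finset.mem_range.mpr (by omega), ?_⟩
    ext i
    fin_cases i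
    · exact he0 _
    · exact (he1 _).trans (Nat.sub_eq_of_eq_add' hdeg.symm)
  rw [MvPolynomial.eval_eq', Finset.sum_subset hsub, Finset.sum_image, binaryForm]
  · simp [Fin.prod_univ_two, he0, he1]
  · intro k _ l _ hkl
    rw [← he0 k, hkl, he0]
  · intro d _ hd
    rw [MvPolynomial.notMem_support_iff.mp hd, zero_mul]

/-- A binary form of degree `n` is determined by its values at `n + 1` points of the projective
line. -/
theorem eval_eq_of_eval_nodes_eq {K : Type*} [Field K] {n : ℕ} {p : MvPolynomial (Fin 2) K}
    (hp : p.IsHomogeneous n) (c : ℕ → K) (v w : Fin (n + 1) → K)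
    (hvw : ∀ i j, i < j → v j * w i - v i * w j ≠ 0)
    (h : ∀ i, MvPolynomial.eval ![v i, w i] p = binaryForm n c (v i) (w i)) (ξ : Fin 2 → K) :
    MvPolynomial.eval ξ p = binaryForm n c (ξ 0) (ξ 1) := by
  obtain ⟨a, ha⟩ := eval_eq_binaryForm_of_isHomogeneous hp
  have hdet : (Matrix.projVandermonde v w).det ≠ 0 := by
    rw [Matrix.det_projVandermonde]
    exact Finset.prod_ne_zero_iff.mpr fun i _ => Finset.prod_ne_zero_iff.mpr fun j hj =>
      hvw i j (Finset.mem_Ioi.mp hj)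
  have hzero : (fun k : Fin (n + 1) => a k - c k) = 0 := by
    refine Matrix.eq_zero_of_mulVec_eq_zero hdet ?_
    ext i
    have := h i
    rw [ha, binaryForm, binaryForm, ← sub_eq_zero, ← Finset.sum_sub_distrib] at this
    rw [Pi.zero_apply, Matrix.mulVec, dotProduct, ← this, ← Fin.sum_univ_eq_sum_range (fun k =>
      a k * ((![v i, w i] 0) ^ k * (![v i, w i] 1) ^ (n - k)) - c k * (v i ^ k * w i ^ (n - k)))]
    refine Finset.sum_congr rfl fun k _ => ?_
    simp only [Matrix.projVandermonde_apply, Fin.val_rev, Matrix.cons_val_zero, Matrix.cons_val_one,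
      Nat.add_sub_add_right]
    ring
  rw [ha, binaryForm, binaryForm]
  refine Finset.sum_congr rfl fun k hk => ?_
  have := congrFun hzero ⟨k, Finset.mem_range.mp hk⟩
  rw [sub_eq_zero.mp this]

/-- A common denominator of the coefficients of the interpolating forms. -/
def commonDenom : ℤ :=
  259029177080458595011050268246419308229635645339981756631366424598164145419447910400000

/-- The coefficients of `x ^ k * y ^ (11 - k)` in `commonDenom * q j`. -/
def numeratorList : Fin 3 → List ℤ :=
  ![[-1178089049643133931513286935049033087307780873685225485089616431088887217920,
     -467287400588702357095393277471362133747359766465658149494504069485817178496,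
     68784377705505513935347581581861516123518113059952057891243934453920563492112,
     -166197879740153028519252236335832560810250626576131858459531659178712415752224,
     -406171318228508559670338161555192719077143078969785384855801490622753225137988,
     1176767910887625366576567699421979466471794230573163273062584711882802154936136,
     755718117580564772247912173085355169280553674190219767552734583585972101004624,
     -1952649608442240444953049388239339243788091179463520576458383573122426111945896,
     -935197606861021312140208439211335088373719177794220246658935850192875474060972,
     277526086311080517484938425692127279706120500136225885212401458338189055837600,
     163106031253418892704282046987813050316866852639752359652392494031030016274544,
     13722470108359827630697394859672449462152210385001705593679714607967634468480],
    [-1757126862473466426246660080421766051055816504100927533200207752431983908480,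
     -695813189919726045054080456924182591835687100744112444354443166730496757824,
     102774749252295845070427121935527356111703185537507299751180441167292209630488,
     -248891078404719617073602165183835559468924633255137277563137132568024533386896,
     -606307225059247673139930387073530351451534658408011209375255807934445962620102,
     1762915435509829041699907754682479085264950237978364328651041633918313635314724,
     1126452319665140232197752412736757583926523153122192797720474107818425751842216,
     -2928697441306585913704111438051230790392937912745645989695759258007017514354884,
     -1400366691337981381500065032327134501216395116956928090789097189857701112903938,
     416444517239406465498711325289542559751957416760031082135515404582163996156560,
     244437404095638935190823779778475230122816178060818110428528565866087434037416,
     20558319492517606455624414127159887979300769907876677636179525432608512310720],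
    [3699983109404199064183134959826356654858936546331719750653290916776419129280,
     1443315497520114347844716342920961244600415996627638621365912483090221296864,
     -216396978577269967986055873666286284945022189219034427587294966342015975152388,
     524823226657687893415127881724573765998533756106332331214697229929264942917936,
     1276491652738343385227090727314303974835345624759353384705758344798563298967257,
     -3717855056905220722279953926073570622219106495366459352400994870289119710677044,
     -2373942148928667737322598563981970026355695602363090216874402178132594643571846,
     6177961725791439698796256645674452269499247908258449128107072889999655605798644,
     2956390165642332184591155796994223193922790108824968756293183783308920279424533,
     -878276750661090225423390931087000203295199932981431608003292366440995072233680,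
     -516155412140983742798684295610628539857881887675355767051035059663388584498436,
     -43426597489245866818657884860765061634607265903950800719213203477155623201120]]

/-- The coefficient sequences of the numerators, extended by zero. -/
def numerator (j : Fin 3) (k : ℕ) : ℤ := (numeratorList j).getD k 0

/-- The abscissae of the interpolation points. -/
def nodeX : Fin 12 → ℤ := ![-14, 19, 11, -4, -7, 6, 2, -18, -7, -9, 6, -20]

/-- The ordinates of the interpolation points. -/
def nodeY : Fin 12 → ℤ := ![5, -8, -14, -17, -3, 16, -17, 2, -14, 19, 18, -9]

theorem node_independent : ∀ i j, i < j → nodeX j * nodeY i - nodeX i * nodeY j ≠ 0 := by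
  decide +kernel

/-- The pairs of forms that vanish simultaneously when `𝔸(ξ)` annihilates one of
`e₀, e₁, e₂, e₀ - e₁, e₀ - e₂, e₁ - e₂`. -/
def critical : Fin 6 → (ℕ → ℤ) × (ℕ → ℤ) :=
  ![(numerator 1, numerator 2), (numerator 0, numerator 2), (numerator 0, numerator 1),
    (numerator 2, numerator 0 + numerator 1), (numerator 1, numerator 0 + numerator 2),
    (numerator 0, numerator 1 + numerator 2)]

/-- Inverses modulo `29` of the Bezout matrices of the pairs `critical`. -/
def bezoutInverse : Fin 6 → Fin 11 → Fin 11 → ℤ :=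
  ![![![17, 7, 11, 8, 26, 18, 28, 13, 19, 19, 22],
      ![7, 11, 8, 26, 18, 28, 13, 19, 19, 22, 11],
      ![11, 8, 26, 18, 28, 13, 19, 19, 22, 11, 1],
      ![8, 26, 18, 28, 13, 19, 19, 22, 11, 1, 28],
      ![26, 18, 28, 13, 19, 19, 22, 11, 1, 28, 15],
      ![18, 28, 13, 19, 19, 22, 11, 1, 28, 15, 19],
      ![28, 13, 19, 19, 22, 11, 1, 28, 15, 19, 18],
      ![13, 19, 19, 22, 11, 1, 28, 15, 19, 18, 13],
      ![19, 19, 22, 11, 1, 28, 15, 19, 18, 13, 15],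
      ![19, 22, 11, 1, 28, 15, 19, 18, 13, 15, 19],
      ![22, 11, 1, 28, 15, 19, 18, 13, 15, 19, 19]],
    ![![0, 4, 9, 21, 13, 22, 20, 16, 11, 2, 3],
      ![4, 9, 21, 13, 22, 20, 16, 11, 2, 3, 26],
      ![9, 21, 13, 22, 20, 16, 11, 2, 3, 26, 22],
      ![21, 13, 22, 20, 16, 11, 2, 3, 26, 22, 11],
      ![13, 22, 20, 16, 11, 2, 3, 26, 22, 11, 7],
      ![22, 20, 16, 11, 2, 3, 26, 22, 11, 7, 19],
      ![20, 16, 11, 2, 3, 26, 22, 11, 7, 19, 15],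
      ![16, 11, 2, 3, 26, 22, 11, 7, 19, 15, 21],
      ![11, 2, 3, 26, 22, 11, 7, 19, 15, 21, 28],
      ![2, 3, 26, 22, 11, 7, 19, 15, 21, 28, 12],
      ![3, 26, 22, 11, 7, 19, 15, 21, 28, 12, 22]],
    ![![16, 19, 19, 10, 28, 18, 28, 11, 6, 22, 18],
      ![19, 19, 10, 28, 18, 28, 11, 6, 22, 18, 9],
      ![19, 10, 28, 18, 28, 11, 6, 22, 18, 9, 3],
      ![10, 28, 18, 28, 11, 6, 22, 18, 9, 3, 12],
      ![28, 18, 28, 11, 6, 22, 18, 9, 3, 12, 24],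
      ![18, 28, 11, 6, 22, 18, 9, 3, 12, 24, 3],
      ![28, 11, 6, 22, 18, 9, 3, 12, 24, 3, 21],
      ![11, 6, 22, 18, 9, 3, 12, 24, 3, 21, 27],
      ![6, 22, 18, 9, 3, 12, 24, 3, 21, 27, 14],
      ![22, 18, 9, 3, 12, 24, 3, 21, 27, 14, 19],
      ![18, 9, 3, 12, 24, 3, 21, 27, 14, 19, 6]],
    ![![22, 1, 15, 0, 1, 1, 3, 6, 24, 13, 0],
      ![1, 15, 0, 1, 1, 3, 6, 24, 13, 0, 17],
      ![15, 0, 1, 1, 3, 6, 24, 13, 0, 17, 15],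
      ![0, 1, 1, 3, 6, 24, 13, 0, 17, 15, 27],
      ![1, 1, 3, 6, 24, 13, 0, 17, 15, 27, 14],
      ![1, 3, 6, 24, 13, 0, 17, 15, 27, 14, 22],
      ![3, 6, 24, 13, 0, 17, 15, 27, 14, 22, 2],
      ![6, 24, 13, 0, 17, 15, 27, 14, 22, 2, 24],
      ![24, 13, 0, 17, 15, 27, 14, 22, 2, 24, 7],
      ![13, 0, 17, 15, 27, 14, 22, 2, 24, 7, 16],
      ![0, 17, 15, 27, 14, 22, 2, 24, 7, 16, 13]],
    ![![4, 13, 25, 25, 22, 1, 27, 28, 19, 3, 15],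
      ![13, 25, 25, 22, 1, 27, 28, 19, 3, 15, 26],
      ![25, 25, 22, 1, 27, 28, 19, 3, 15, 26, 28],
      ![25, 22, 1, 27, 28, 19, 3, 15, 26, 28, 5],
      ![22, 1, 27, 28, 19, 3, 15, 26, 28, 5, 5],
      ![1, 27, 28, 19, 3, 15, 26, 28, 5, 5, 10],
      ![27, 28, 19, 3, 15, 26, 28, 5, 5, 10, 23],
      ![28, 19, 3, 15, 26, 28, 5, 5, 10, 23, 26],
      ![19, 3, 15, 26, 28, 5, 5, 10, 23, 26, 25],
      ![3, 15, 26, 28, 5, 5, 10, 23, 26, 25, 20],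
      ![15, 26, 28, 5, 5, 10, 23, 26, 25, 20, 3]],
    ![![4, 20, 22, 19, 15, 3, 0, 10, 1, 11, 12],
      ![20, 22, 19, 15, 3, 0, 10, 1, 11, 12, 6],
      ![22, 19, 15, 3, 0, 10, 1, 11, 12, 6, 14],
      ![19, 15, 3, 0, 10, 1, 11, 12, 6, 14, 22],
      ![15, 3, 0, 10, 1, 11, 12, 6, 14, 22, 18],
      ![3, 0, 10, 1, 11, 12, 6, 14, 22, 18, 17],
      ![0, 10, 1, 11, 12, 6, 14, 22, 18, 17, 22],
      ![10, 1, 11, 12, 6, 14, 22, 18, 17, 22, 7],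
      ![1, 11, 12, 6, 14, 22, 18, 17, 22, 7, 0],
      ![11, 12, 6, 14, 22, 18, 17, 22, 7, 0, 8],
      ![12, 6, 14, 22, 18, 17, 22, 7, 0, 8, 19]]]

theorem bezoutInverse_mul (s : Fin 6) : ∀ i j,
    (Matrix.of (bezoutInverse s) * bezoutMatrix 11 (critical s).1 (critical s).2) i j ≡
      (1 : Matrix (Fin 11) (Fin 11) ℤ) i j [ZMOD (29 : ℕ)] := by
  unfold Int.ModEq
  revert s
  decide +kernel

theorem numerator_eq_zero (j : Fin 3) (k : ℕ) (hk : 11 < k) : numerator j k = 0 := by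
  refine List.getD_eq_default _ _ ?_
  fin_cases j <;> exact hk

theorem critical_no_common_zero (s : Fin 6) {x y : ℝ} (hxy : x ≠ 0 ∨ y ≠ 0)
    (h : binaryForm 11 (fun k => ((critical s).1 k : ℝ)) x y = 0) :
    binaryForm 11 (fun k => ((critical s).2 k : ℝ)) x y ≠ 0 := by
  refine no_common_zero (by norm_num) (fun k hk => ?_) (fun k hk => ?_) _ (by norm_num)
    (bezoutInverse_mul s) hxy h <;>
  fin_cases s <;> simp [critical, numerator_eq_zero _ k hk]

set_option maxHeartbeats 2000000 in
theorem cVal_eq_binaryForm (i : Fin 3) (l : Fin 4) (j : Fin 3) :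
    cVal i l j =
      binaryForm 11 (fun k => (numerator j k : ℝ) / commonDenom) (xiVal i l 0) (xiVal i l 1) := by
  fin_cases i <;> fin_cases l <;> fin_cases j <;>
    norm_num [cVal, xiVal, binaryForm, numerator, numeratorList, Finset.sum_range_succ,
      commonDenom]

theorem exists_xiVal_eq_node (k : Fin 12) : ∃ i l, xiVal i l = ![(nodeX k : ℝ), (nodeY k : ℝ)] := by
  refine ⟨Fin.divNat (m := 3) (n := 4) k, Fin.modNat (m := 3) (n := 4) k, ?_⟩
  fin_cases k <;> simp [xiVal, nodeX, nodeY, Fin.divNat, Fin.modNat]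

theorem commonDenom_mul_eval {q : Fin 3 → MvPolynomial (Fin 2) ℝ} (hq : InterpCond q) (j : Fin 3)
    (ξ : Fin 2 → ℝ) : commonDenom * MvPolynomial.eval ξ (q j) =
      binaryForm 11 (fun k => (numerator j k : ℝ)) (ξ 0) (ξ 1) := by
  rw [eval_eq_of_eval_nodes_eq (hq.1 j) (fun k => (numerator j k : ℝ) / commonDenom)
    (fun k => nodeX k) (fun k => nodeY k)
    (fun i j hij => by exact_mod_cast node_independent i j hij) (fun k => ?_), binaryForm,
    binaryForm, Finset.mul_sum]
  · have hD : (commonDenom : ℝ) ≠ 0 := by norm_num [commonDenom]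
    refine Finset.sum_congr rfl fun k _ => ?_
    field_simp
  · obtain ⟨i, l, h⟩ := exists_xiVal_eq_node k
    rw [← h, hq.2, cVal_eq_binaryForm, h]
    rfl

theorem binaryForm_add {R : Type*} [CommRing R] (n : ℕ) (f g : ℕ → R) (x y : R) :
    binaryForm n (fun k => f k + g k) x y = binaryForm n f x y + binaryForm n g x y := by
  simp [binaryForm, add_mul, Finset.sum_add_distrib]

theorem eval_critical {q : Fin 3 → MvPolynomial (Fin 2) ℝ} (hq : InterpCond q) {ξ : Fin 2 → ℝ}
    (hξ : ξ ≠ 0) :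
    ¬(MvPolynomial.eval ξ (q 1) = 0 ∧ MvPolynomial.eval ξ (q 2) = 0) ∧
    ¬(MvPolynomial.eval ξ (q 0) = 0 ∧ MvPolynomial.eval ξ (q 2) = 0) ∧
    ¬(MvPolynomial.eval ξ (q 0) = 0 ∧ MvPolynomial.eval ξ (q 1) = 0) ∧
    ¬(MvPolynomial.eval ξ (q 2) = 0 ∧
      MvPolynomial.eval ξ (q 0) + MvPolynomial.eval ξ (q 1) = 0) ∧
    ¬(MvPolynomial.eval ξ (q 1) = 0 ∧
      MvPolynomial.eval ξ (q 0) + MvPolynomial.eval ξ (q 2) = 0) ∧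
    ¬(MvPolynomial.eval ξ (q 0) = 0 ∧
      MvPolynomial.eval ξ (q 1) + MvPolynomial.eval ξ (q 2) = 0) := by
  have hxy : ξ 0 ≠ 0 ∨ ξ 1 ≠ 0 := by
    by_contra! h
    exact hξ (funext fun i => by fin_cases i <;> simp [h.1, h.2])
  have hsingle (j : Fin 3) (h : MvPolynomial.eval ξ (q j) = 0) :
      binaryForm 11 (fun k => (numerator j k : ℝ)) (ξ 0) (ξ 1) = 0 := by
    rw [← commonDenom_mul_eval hq, h, mul_zero]
  have hsum (i j : Fin 3) (h : MvPolynomial.eval ξ (q i) + MvPolynomial.eval ξ (q j) = 0) :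
      binaryForm 11 (fun k => (((numerator i + numerator j) k : ℤ) : ℝ)) (ξ 0) (ξ 1) = 0 := by
    simp only [Pi.add_apply, Int.cast_add]
    rw [binaryForm_add, ← commonDenom_mul_eval hq, ← commonDenom_mul_eval hq, ← mul_add, h,
      mul_zero]
  exact ⟨fun h => critical_no_common_zero 0 hxy (hsingle 1 h.1) (hsingle 2 h.2),
    fun h => critical_no_common_zero 1 hxy (hsingle 0 h.1) (hsingle 2 h.2),
    fun h => critical_no_common_zero 2 hxy (hsingle 0 h.1) (hsingle 1 h.2),
    fun h => critical_no_common_zero 3 hxy (hsingle 2 h.1) (hsum 0 1 h.2),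
    fun h => critical_no_common_zero 4 hxy (hsingle 1 h.1) (hsum 0 2 h.2),
    fun h => critical_no_common_zero 5 hxy (hsingle 0 h.1) (hsum 1 2 h.2)⟩

theorem AMat_mulVec_eq_zero_iff (q : Fin 3 → MvPolynomial (Fin 2) ℝ) (ξ : Fin 2 → ℝ)
    (v : Fin 3 → ℝ) : (AMat q ξ).mulVec v = 0 ↔
      MvPolynomial.eval ξ (q 1) * v 2 = MvPolynomial.eval ξ (q 2) * v 1 ∧
      MvPolynomial.eval ξ (q 0) * v 2 = MvPolynomial.eval ξ (q 2) * v 0 ∧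
      MvPolynomial.eval ξ (q 0) * v 1 = MvPolynomial.eval ξ (q 1) * v 0 := by
  rw [funext_iff, Fin.forall_fin_succ, Fin.forall_fin_succ, Fin.forall_fin_one]
  simp only [AMat, Matrix.mulVec, dotProduct, Fin.sum_univ_three]
  simp only [Matrix.of_apply, Matrix.cons_val', Matrix.cons_val_zero, Matrix.cons_val_one,
    Matrix.cons_val, Fin.succ_zero_eq_one, Fin.succ_one_eq_two, Pi.zero_apply]
  constructor <;> rintro ⟨h0, h1, h2⟩ <;> refine ⟨?_, ?_, ?_⟩ <;> linarith

theorem ker_AMat {q : Fin 3 → MvPolynomial (Fin 2) ℝ} {ξ : Fin 2 → ℝ}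
    (h : (fun j => MvPolynomial.eval ξ (q j)) ≠ 0) :
    LinearMap.ker (AMat q ξ).mulVecLin =
      Submodule.span ℝ {fun j : Fin 3 => MvPolynomial.eval ξ (q j)} := by
  ext v
  rw [LinearMap.mem_ker, Matrix.mulVecLin_apply, AMat_mulVec_eq_zero_iff,
    Submodule.mem_span_singleton]
  constructor
  · rintro ⟨h0, h1, h2⟩
    obtain ⟨j, hj⟩ := Function.ne_iff.mp h
    rw [Pi.zero_apply] at hj
    refine ⟨v j / MvPolynomial.eval ξ (q j), funext fun i => ?_⟩
    rw [Pi.smul_apply, smul_eq_mul, div_mul_eq_mul_div, div_eq_iff hj]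
    fin_cases j <;> fin_cases i <;> simp only [Fin.zero_eta, Fin.mk_one, Fin.reduceFinMk] <;>
      linarith
  · rintro ⟨t, rfl⟩
    simp only [Pi.smul_apply, smul_eq_mul]
    refine ⟨?_, ?_, ?_⟩ <;> ring

theorem rank_AMat {q : Fin 3 → MvPolynomial (Fin 2) ℝ} {ξ : Fin 2 → ℝ}
    (h : (fun j => MvPolynomial.eval ξ (q j)) ≠ 0) : (AMat q ξ).rank = 2 := by
  have := (AMat q ξ).mulVecLin.finrank_range_add_finrank_ker
  rw [ker_AMat h, finrank_span_singleton h, Module.finrank_fin_fun] at this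
  exact Nat.add_right_cancel this

theorem range_column (u : Fin 3 → ℝ) :
    LinearMap.range (Matrix.of fun (j : Fin 3) (_ : Fin 1) => u j).mulVecLin =
      Submodule.span ℝ {u} := by
  rw [Matrix.range_mulVecLin]
  congr 1
  exact Set.range_unique

theorem cVal_mem_LamA {q : Fin 3 → MvPolynomial (Fin 2) ℝ} (hq : InterpCond q) (i : Fin 3)
    (l : Fin 4) : cVal i l ∈ LamA q := by
  refine ⟨xiVal i l, fun h => ?_, ?_⟩
  · have := congrFun h 0
    fin_cases i <;> fin_cases l <;> simp [xiVal] at this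
  · rw [AMat_mulVec_eq_zero_iff, hq.2, hq.2, hq.2]
    refine ⟨?_, ?_, ?_⟩ <;> ring

theorem span_LamA_eq_top {q : Fin 3 → MvPolynomial (Fin 2) ℝ} (hq : InterpCond q) :
    Submodule.span ℝ (LamA q) = ⊤ := by
  refine eq_top_iff.mpr fun v _ => ?_
  have hmem (l : Fin 4) (t : ℝ) : t • cVal 0 l ∈ Submodule.span ℝ (LamA q) :=
    Submodule.smul_mem _ _ (Submodule.subset_span (cVal_mem_LamA hq 0 l))
  have hv : v = (-v 0 - v 1 - 3 * v 2) • cVal 0 0 + (2 * v 0 + v 1 - v 2) • cVal 0 1 +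
      (2 * v 1 - v 2) • cVal 0 2 := by
    ext i
    fin_cases i <;> simp [cVal] <;> ring
  rw [hv]
  exact Submodule.add_mem _ (Submodule.add_mem _ (hmem 0 _) (hmem 1 _)) (hmem 2 _)

/-- **Corollary 5.4 of the paper:** the explicit operator `𝒜` with symbol `AMat q` has no
`Λ_𝒜`-connections between the four states, has constant rank `2` with
`ker 𝔸(ξ) = im 𝔹(ξ) = span{(q₁(ξ), q₂(ξ), q₃(ξ))}`, and is balanced. -/
theorem explicit_operator_properties
    (q : Fin 3 → MvPolynomial (Fin 2) ℝ) (hq : InterpCond q) :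
    -- (i) no wave-cone connections between the states
    (∀ i j : Fin 4, i ≠ j → aPt i - aPt j ∉ LamA q) ∧
    -- (ii) constant rank 2 and `𝓑` is a potential of `𝒜`
    (∀ ξ : Fin 2 → ℝ, ξ ≠ 0 →
      (AMat q ξ).rank = 2 ∧
      LinearMap.ker (AMat q ξ).mulVecLin =
        LinearMap.range (Matrix.of fun (j : Fin 3) (_ : Fin 1) =>
          MvPolynomial.eval ξ (q j)).mulVecLin ∧
      LinearMap.ker (AMat q ξ).mulVecLin =
        Submodule.span ℝ {fun j : Fin 3 => MvPolynomial.eval ξ (q j)}) ∧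
    -- (iii) `𝒜` is balanced
    Submodule.span ℝ (LamA q) = ⊤ := by
  have hne (ξ : Fin 2 → ℝ) (hξ : ξ ≠ 0) : (fun j => MvPolynomial.eval ξ (q j)) ≠ 0 := fun h =>
    (eval_critical hq hξ).1 ⟨congrFun h 1, congrFun h 2⟩
  refine ⟨?_, fun ξ hξ => ⟨rank_AMat (hne ξ hξ), ?_, ker_AMat (hne ξ hξ)⟩, span_LamA_eq_top hq⟩
  · rintro i j hij ⟨ξ, hξ, h⟩
    obtain ⟨h0, h1, h2, h3, h4, h5⟩ := eval_critical hq hξ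
    rw [AMat_mulVec_eq_zero_iff] at h
    fin_cases i <;> fin_cases j <;> simp [aPt] at h hij <;> grind
  · rw [ker_AMat (hne ξ hξ), range_column]
end

section
/- Let 𝒜 be a homogeneous linear differential operator of order 1, given by constant matrices A_1, …, A_m ∈ ℝ^{N×n} acting by 𝒜v = Σ_{i=1}^m A_i ∂_i v, with symbol 𝔸(ξ) = Σ_{i=1}^m ξ_i A_i and wave cone Λ_𝒜 = ⋃_{ξ≠0} ker 𝔸(ξ). Let Ω ⊂ ℝ^m be open and connected, let a_1, a_2, a_3 ∈ ℝ^n satisfy a_i − a_j ∉ Λ_𝒜 for i ≠ j, and let u ∈ L^∞(Ω; ℝ^n) satisfy u(x) ∈ {a_1, a_2, a_3} a.e. and 𝒜(u) = 0 in the sense of distributions. Then u is a.e. equal to a constant. (Rigidity of the three-state problem for operators of order 1.) -/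
open MeasureTheory Metric Set Matrix Filter

theorem Matrix.eventually_det_add_smul_ne_zero {ι : Type*} [Fintype ι] [DecidableEq ι]
    {X : Matrix ι ι ℝ} (hX : X.det ≠ 0) (Y : Matrix ι ι ℝ) :
    ∀ᶠ t : ℝ in nhdsWithin 0 {0}ᶜ, (X + t • Y).det ≠ 0 := by
  have hc : Continuous fun t : ℝ => (X + t • Y).det := by fun_prop
  refine (hc.tendsto 0).eventually_ne (by simpa using hX) |>.filter_mono nhdsWithin_le_nhds

theorem Matrix.eventually_det_add_smul_one_ne_zero {ι : Type*} [Fintype ι] [DecidableEq ι]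
    (Y : Matrix ι ι ℝ) :
    ∀ᶠ t : ℝ in nhdsWithin 0 {0}ᶜ, (Y + t • (1 : Matrix ι ι ℝ)).det ≠ 0 := by
  have hfin : {t : ℝ | (-Y).charpoly.IsRoot t}.Finite :=
    Polynomial.finite_setOfPred_isRoot (-Y).charpoly_monic.ne_zero
  have h := (hfin.subset (sdiff_subset (t := {0}))).isClosed.compl_mem_nhds
    (x := (0 : ℝ)) (by simp)
  filter_upwards [nhdsWithin_le_nhds h, self_mem_nhdsWithin] with t ht h0 hdet
  refine ht ⟨?_, h0⟩
  rw [mem_ofPred_eq, Polynomial.IsRoot.def, Matrix.eval_charpoly, ← hdet, sub_neg_eq_add, add_comm,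
    Matrix.scalar_apply, Matrix.smul_one_eq_diagonal]

theorem Matrix.exists_mul_eq_one_of_mulVec_injective {κ ι : Type*} [Fintype κ] [Fintype ι]
    [DecidableEq κ] [DecidableEq ι] {L : Matrix κ ι ℝ} (hL : Function.Injective L.mulVec) :
    ∃ P : Matrix ι κ ℝ, P * L = 1 := by
  obtain ⟨g, hg⟩ := LinearMap.exists_leftInverse_of_injective L.toLin'
    (LinearMap.ker_eq_bot.2 hL)
  refine ⟨LinearMap.toMatrix' g, ?_⟩
  rw [← LinearMap.toMatrix'_toLin' L, ← LinearMap.toMatrix'_comp, hg, LinearMap.toMatrix'_id]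

/-- Three injective matrices of the same shape can be multiplied on the left by one matrix making
the first the identity and the other two invertible. -/
theorem Matrix.exists_common_left_inverse {κ ι : Type*} [Fintype κ] [Fintype ι]
    [DecidableEq κ] [DecidableEq ι] {L₁ L₂ L₃ : Matrix κ ι ℝ}
    (h₁ : Function.Injective L₁.mulVec) (h₂ : Function.Injective L₂.mulVec)
    (h₃ : Function.Injective L₃.mulVec) :
    ∃ P : Matrix ι κ ℝ, P * L₁ = 1 ∧ (P * L₂).det ≠ 0 ∧ (P * L₃).det ≠ 0 := by
  obtain ⟨P₁, hP₁⟩ := exists_mul_eq_one_of_mulVec_injective h₁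
  obtain ⟨P₂, hP₂⟩ := exists_mul_eq_one_of_mulVec_injective h₂
  obtain ⟨P₃, hP₃⟩ := exists_mul_eq_one_of_mulVec_injective h₃
  have hone : (P₁ * L₁).det ≠ 0 := by simp [hP₁]
  obtain ⟨t, ht₁, ht₂⟩ := ((eventually_det_add_smul_ne_zero hone (P₂ * L₁)).and
    (eventually_det_add_smul_one_ne_zero (P₁ * L₂))).exists
  rw [← hP₂, ← smul_mul] at ht₂
  rw [← smul_mul] at ht₁
  rw [← Matrix.add_mul] at ht₁ ht₂
  obtain ⟨s, hs₁, hs₂, hs₃⟩ := ((eventually_det_add_smul_ne_zero ht₁ (P₃ * L₁)).and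
    ((eventually_det_add_smul_ne_zero ht₂ (P₃ * L₂)).and
      (eventually_det_add_smul_one_ne_zero ((P₁ + t • P₂) * L₃)))).exists
  rw [← hP₃, ← smul_mul] at hs₃
  rw [← smul_mul] at hs₁ hs₂
  rw [← Matrix.add_mul] at hs₁ hs₂ hs₃
  set Q := P₁ + t • P₂ + s • P₃
  refine ⟨(Q * L₁)⁻¹ * Q, ?_, ?_, ?_⟩
  · rw [Matrix.mul_assoc, nonsing_inv_mul _ hs₁.isUnit]
  · rw [Matrix.mul_assoc, det_mul]
    exact mul_ne_zero ((isUnit_nonsing_inv_det _ hs₁.isUnit).ne_zero) hs₂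
  · rw [Matrix.mul_assoc, det_mul]
    exact mul_ne_zero ((isUnit_nonsing_inv_det _ hs₁.isUnit).ne_zero) hs₃

/-- Functionals related by `p + q ∘ T = 0` vanish as soon as `p + μ q = 0` at a vector forces both to
vanish there, for every eigenvalue `μ` of `T`. -/
theorem Module.End.forall_eq_zero_of_eigenvalue {V ι : Type*} [AddCommGroup V] [Module ℂ V]
    [FiniteDimensional ℂ V] (T : Module.End ℂ V) (p q : ι → V →ₗ[ℂ] ℂ)
    (hrel : ∀ i w, p i w + q i (T w) = 0)
    (heig : ∀ μ, T.HasEigenvalue μ → ∀ w, (∀ i, p i w + μ * q i w = 0) →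
      ∀ i, p i w = 0 ∧ q i w = 0) (w : V) (i : ι) : p i w = 0 ∧ q i w = 0 := by
  have key : ∀ μ, ∀ k : ℕ, ∀ w, ((T - algebraMap ℂ (Module.End ℂ V) μ) ^ k) w = 0 →
      ∀ i, p i w = 0 ∧ q i w = 0 := by
    intro μ k
    by_cases hμ : T.HasEigenvalue μ
    · induction k with
      | zero => intro w hw i; simp_all
      | succ k ih =>
        intro w hw
        have hd := ih _ (by rwa [pow_succ, Module.End.mul_apply] at hw)
        refine heig μ hμ w fun i => ?_
        have h1 := hrel i w
        have h2 := (hd i).2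
        simp only [LinearMap.sub_apply, Module.algebraMap_end_apply, map_sub, map_smul,
          smul_eq_mul] at h2
        linear_combination h1 - h2
    · intro w hw i
      have hinj : Function.Injective (T - algebraMap ℂ (Module.End ℂ V) μ) := by
        rw [← LinearMap.ker_eq_bot]
        simpa [Module.End.hasEigenvalue_iff, Module.End.eigenspace_def,
          Algebra.algebraMap_eq_smul_one] using hμ
      have : w = 0 := by
        rw [Module.End.coe_pow] at hw
        exact hinj.iterate k (by rw [hw, ← Module.End.coe_pow, map_zero])
      simp [this]
  have hw : w ∈ ⨆ μ, T.maxGenEigenspace μ := by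
    rw [Module.End.iSup_maxGenEigenspace_eq_top]; trivial
  refine Submodule.iSup_induction _ (motive := fun w => p i w = 0 ∧ q i w = 0) hw ?_ (by simp) ?_
  · intro μ x hx
    obtain ⟨k, hk⟩ := (Module.End.mem_maxGenEigenspace T μ x).1 hx
    exact key μ k x (by simpa [Algebra.algebraMap_eq_smul_one] using hk) i
  · rintro x y ⟨hx, hx'⟩ ⟨hy, hy'⟩
    simp [*]

/-- Complex-valued smooth test functions compactly supported in `Ω`. -/
structure IsTestFunction {m : ℕ} (Ω : Set (Fin m → ℝ)) (ψ : (Fin m → ℝ) → ℂ) : Prop where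
  contDiff : ContDiff ℝ (⊤ : ℕ∞) ψ
  hasCompactSupport : HasCompactSupport ψ
  tsupport_subset : tsupport ψ ⊆ Ω

/-- The vector of the integrals `∫ F ∂ᵢψ`. -/
noncomputable def gradPairing {m : ℕ} (F ψ : (Fin m → ℝ) → ℂ) : Fin m → ℂ :=
  fun i => ∫ x, F x * fderiv ℝ ψ x (Pi.single i 1)

/-- `w · ∇F = 0` on `Ω` in the sense of distributions, for a complex direction `w`. -/
def WeakDirDerivZero {m : ℕ} (Ω : Set (Fin m → ℝ)) (w : Fin m → ℂ)
    (F : (Fin m → ℝ) → ℂ) : Prop :=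
  ∀ ψ, IsTestFunction Ω ψ → w ⬝ᵥ gradPairing F ψ = 0

section Mollification

variable {m : ℕ} {Ω : Set (Fin m → ℝ)} {F G ψ : (Fin m → ℝ) → ℂ} {C : ℝ} {w : Fin m → ℂ}

theorem locallyIntegrable_of_bound (hF : AEStronglyMeasurable F) (hC : ∀ x, ‖F x‖ ≤ C) :
    LocallyIntegrable F :=
  (memLp_top_of_bound hF C (Eventually.of_forall hC)).locallyIntegrable le_top

theorem norm_indicator_one_le (S : Set (Fin m → ℝ)) (x : Fin m → ℝ) :
    ‖S.indicator (1 : (Fin m → ℝ) → ℂ) x‖ ≤ 1 := by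
  by_cases hx : x ∈ S <;> simp [hx]

theorem aestronglyMeasurable_indicator_one {S : Set (Fin m → ℝ)} (hS : MeasurableSet S) :
    AEStronglyMeasurable (S.indicator (1 : (Fin m → ℝ) → ℂ)) :=
  aestronglyMeasurable_one.indicator hS

theorem locallyIntegrable_indicator_one {S : Set (Fin m → ℝ)} (hS : MeasurableSet S) :
    LocallyIntegrable (S.indicator (1 : (Fin m → ℝ) → ℂ)) :=
  locallyIntegrable_of_bound (aestronglyMeasurable_indicator_one hS) (norm_indicator_one_le S)

theorem IsTestFunction.continuous_fderiv_apply (hψ : IsTestFunction Ω ψ) (v : Fin m → ℝ) :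
    Continuous fun x => fderiv ℝ ψ x v :=
  (hψ.contDiff.continuous_fderiv (by simp)).clm_apply continuous_const

theorem IsTestFunction.integrable_mul_fderiv (hψ : IsTestFunction Ω ψ)
    (hF : LocallyIntegrable F) (v : Fin m → ℝ) :
    Integrable fun x => F x * fderiv ℝ ψ x v := by
  have := hF.integrable_smul_left_of_hasCompactSupport (hψ.continuous_fderiv_apply v)
    (hψ.hasCompactSupport.fderiv_apply ℝ v)
  simpa [mul_comm] using this

theorem IsTestFunction.integrable_mul (hψ : IsTestFunction Ω ψ) (hF : LocallyIntegrable F) :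
    Integrable fun x => F x * ψ x := by
  have := hF.integrable_smul_left_of_hasCompactSupport hψ.contDiff.continuous
    hψ.hasCompactSupport
  simpa [mul_comm] using this

theorem gradPairing_add_smul (hψ : IsTestFunction Ω ψ)
    (hF : LocallyIntegrable F) (hG : LocallyIntegrable G) (c : ℂ) :
    gradPairing (fun x => F x + c * G x) ψ = gradPairing F ψ + c • gradPairing G ψ := by
  ext i
  simp only [gradPairing, Pi.add_apply, Pi.smul_apply, smul_eq_mul]
  rw [← integral_const_mul, ← integral_add (hψ.integrable_mul_fderiv hF _)
    ((hψ.integrable_mul_fderiv hG _).const_mul c)]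
  congr 1; ext x; ring

theorem gradPairing_const (hψ : IsTestFunction Ω ψ) (c : ℂ) :
    gradPairing (fun _ => c) ψ = 0 := by
  ext i
  have hc : LocallyIntegrable (fun _ : Fin m → ℝ => c) := locallyIntegrable_const c
  have := integral_mul_fderiv_eq_neg_fderiv_mul_of_integrable (μ := volume)
    (f := fun _ : Fin m → ℝ => c) (g := ψ) (v := Pi.single i 1) (by simp)
    (hψ.integrable_mul_fderiv hc _) (hψ.integrable_mul hc) (fun _ _ => by fun_prop)
    (fun x _ => (hψ.contDiff.differentiable (by simp)) x)
  simpa [gradPairing] using this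

/-- A sequence of bump functions at the origin whose supports shrink to a point. -/
noncomputable def shrinkingBump (m n : ℕ) : ContDiffBump (0 : Fin m → ℝ) where
  rIn := 1 / ((n : ℝ) + 1)
  rOut := 2 * (1 / ((n : ℝ) + 1))
  rIn_pos := by positivity
  rIn_lt_rOut := by
    have : 0 < 1 / ((n : ℝ) + 1) := by positivity
    linarith

theorem tendsto_rOut_shrinkingBump (m : ℕ) :
    Tendsto (fun n => (shrinkingBump m n).rOut) atTop (nhds 0) := by
  simpa [shrinkingBump] using (tendsto_one_div_add_atTop_nhds_zero_nat (𝕜 := ℝ)).const_mul 2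

/-- Mollification of `F` at the `n`-th scale. -/
noncomputable def mollify (F : (Fin m → ℝ) → ℂ) (n : ℕ) : (Fin m → ℝ) → ℂ :=
  convolution ((shrinkingBump m n).normed volume) F (ContinuousLinearMap.lsmul ℝ ℝ) volume

theorem contDiff_mollify (hF : LocallyIntegrable F) (n : ℕ) :
    ContDiff ℝ (⊤ : ℕ∞) (mollify F n) :=
  (shrinkingBump m n).hasCompactSupport_normed.contDiff_convolution_left _
    (shrinkingBump m n).contDiff_normed hF

theorem norm_mollify_le (hF : AEStronglyMeasurable F) (hC : ∀ x, ‖F x‖ ≤ C) (n : ℕ)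
    (x : Fin m → ℝ) : ‖mollify F n x‖ ≤ C := by
  have := dist_convolution_le (z₀ := (0 : ℂ)) (x₀ := x) ((norm_nonneg _).trans (hC x))
    (shrinkingBump m n).support_normed_eq.subset (shrinkingBump m n).nonneg_normed
    ((shrinkingBump m n).integral_normed (μ := volume)) hF (fun y _ => by simpa using hC y)
  simpa [mollify] using this

theorem ae_tendsto_mollify (hF : LocallyIntegrable F) :
    ∀ᵐ x, Tendsto (fun n => mollify F n x) atTop (nhds (F x)) :=
  ContDiffBump.ae_convolution_tendsto_right_of_locallyIntegrable (K := 2)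
    (tendsto_rOut_shrinkingBump m) (Eventually.of_forall fun _ => le_rfl) hF

theorem fderiv_mollify_apply (hF : LocallyIntegrable F) (n : ℕ) (x v : Fin m → ℝ) :
    fderiv ℝ (mollify F n) x v =
      -∫ y, F y * fderiv ℝ
        (fun y => (((shrinkingBump m n).normed volume (x - y) : ℝ) : ℂ)) y v := by
  set f := (shrinkingBump m n).normed volume with hf
  have hfc : HasCompactSupport f := (shrinkingBump m n).hasCompactSupport_normed
  have hfs : ContDiff ℝ (1 : ℕ∞) f := (shrinkingBump m n).contDiff_normed
  have h := hfc.hasFDerivAt_convolution_left (ContinuousLinearMap.lsmul ℝ ℝ) hfs hF x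
  rw [mollify, h.fderiv, convolution_eq_swap, ContinuousLinearMap.integral_apply, ← integral_neg]
  · congr 1
    ext y
    have hd : HasFDerivAt (fun y => ((f (x - y) : ℝ) : ℂ))
        (Complex.ofRealCLM.comp ((fderiv ℝ f (x - y)).comp (-ContinuousLinearMap.id ℝ _))) y := by
      refine Complex.ofRealCLM.hasFDerivAt.comp y (HasFDerivAt.comp y
        ((hfs.differentiable (by simp)) (x - y)).hasFDerivAt ?_)
      simpa using (hasFDerivAt_id (𝕜 := ℝ) y).const_sub x
    rw [hd.fderiv]
    simp [ContinuousLinearMap.precompL_apply, mul_comm]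
  · exact ((hfc.fderiv ℝ).convolutionExists_left _ (hfs.continuous_fderiv (by simp))
      hF x).integrable_swap

theorem isTestFunction_shrinkingBump {n : ℕ} {x : Fin m → ℝ}
    (hx : closedBall x (shrinkingBump m n).rOut ⊆ Ω) :
    IsTestFunction Ω fun y => (((shrinkingBump m n).normed volume (x - y) : ℝ) : ℂ) := by
  have hsub : tsupport (fun y => (((shrinkingBump m n).normed volume (x - y) : ℝ) : ℂ)) ⊆
      closedBall x (shrinkingBump m n).rOut := by
    refine closure_minimal (fun y hy => ?_) isClosed_closedBall
    have : x - y ∈ Function.support ((shrinkingBump m n).normed volume) := by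
      simpa [Function.mem_support] using hy
    rw [ContDiffBump.support_normed_eq] at this
    rw [mem_closedBall, dist_comm, dist_eq_norm]
    simpa using (mem_ball.1 this).le
  refine ⟨?_, ?_, hsub.trans hx⟩
  · exact Complex.ofRealCLM.contDiff.comp ((shrinkingBump m n).contDiff_normed.comp
      (contDiff_const.sub contDiff_id))
  · exact HasCompactSupport.of_support_subset_isCompact (isCompact_closedBall _ _)
      ((subset_tsupport _).trans hsub)

theorem WeakDirDerivZero.sum_mul_fderiv_mollify_eq_zero (hw : WeakDirDerivZero Ω w F) (hF : LocallyIntegrable F)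
    {n : ℕ} {x : Fin m → ℝ} (hx : closedBall x (shrinkingBump m n).rOut ⊆ Ω) :
    ∑ i, w i * fderiv ℝ (mollify F n) x (Pi.single i 1) = 0 := by
  have h := hw _ (isTestFunction_shrinkingBump hx)
  simp only [dotProduct, gradPairing] at h
  simp only [fderiv_mollify_apply hF, mul_neg, Finset.sum_neg_distrib, h, neg_zero]

theorem eventually_forall_closedBall_subset {K : Set (Fin m → ℝ)} (hΩ : IsOpen Ω) (hK : IsCompact K)
    (hKΩ : K ⊆ Ω) :
    ∀ᶠ n in atTop, ∀ x ∈ K, closedBall x (shrinkingBump m n).rOut ⊆ Ω := by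
  obtain ⟨δ, hδ, hsub⟩ := hK.exists_cthickening_subset_open hΩ hKΩ
  filter_upwards [(tendsto_rOut_shrinkingBump m).eventually (gt_mem_nhds hδ)] with n hn x hx
  exact (closedBall_subset_closedBall hn.le).trans
    ((closedBall_subset_cthickening hx δ).trans hsub)

/-- If `w · ∇F = 0` weakly for a bounded `F`, then also `w · ∇(F²) = 0`. -/
theorem WeakDirDerivZero.sq (hΩ : IsOpen Ω) (hF : AEStronglyMeasurable F)
    (hC : ∀ x, ‖F x‖ ≤ C) (hw : WeakDirDerivZero Ω w F) :
    WeakDirDerivZero Ω w fun x => F x ^ 2 := by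
  intro ψ hψ
  have hloc := locallyIntegrable_of_bound hF hC
  have hsm := contDiff_mollify hloc
  have hzero : ∀ᶠ n in atTop,
      w ⬝ᵥ gradPairing (fun x => F x * mollify F n x) ψ = 0 := by
    filter_upwards [eventually_forall_closedBall_subset hΩ hψ.hasCompactSupport hψ.tsupport_subset]
      with n hn
    have htest : IsTestFunction Ω fun x => mollify F n x * ψ x :=
      ⟨(hsm n).mul hψ.contDiff, hψ.hasCompactSupport.mul_left,
        (tsupport_mul_subset_right).trans hψ.tsupport_subset⟩
    have hlocm : LocallyIntegrable fun x => F x * mollify F n x := by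
      refine locallyIntegrable_of_bound (C := C * C)
        (hF.mul (hsm n).continuous.aestronglyMeasurable) fun x => ?_
      rw [norm_mul]
      exact mul_le_mul (hC x) (norm_mollify_le hF hC n x) (norm_nonneg _)
        ((norm_nonneg _).trans (hC x))
    rw [← hw _ htest]
    simp only [dotProduct, gradPairing, ← integral_const_mul]
    rw [← integral_finsetSum _ fun i _ => (hψ.integrable_mul_fderiv hlocm _).const_mul _,
      ← integral_finsetSum _ fun i _ => (htest.integrable_mul_fderiv hloc _).const_mul _]
    congr 1
    ext x
    have hfd : ∀ v, fderiv ℝ (fun x => mollify F n x * ψ x) x v =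
        mollify F n x * fderiv ℝ ψ x v + ψ x * fderiv ℝ (mollify F n) x v := by
      intro v
      rw [fderiv_fun_mul ((hsm n).differentiable (by simp) x)
        (hψ.contDiff.differentiable (by simp) x)]
      simp
    have hx : ψ x * ∑ i, w i * fderiv ℝ (mollify F n) x (Pi.single i 1) = 0 := by
      by_cases hxs : x ∈ tsupport ψ
      · rw [hw.sum_mul_fderiv_mollify_eq_zero hloc (hn x hxs), mul_zero]
      · rw [image_eq_zero_of_notMem_tsupport hxs, zero_mul]
    simp only [hfd]
    rw [← sub_eq_zero, ← Finset.sum_sub_distrib]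
    rw [Finset.mul_sum] at hx
    have := congrArg (fun z => -F x * z) hx
    simp only [mul_zero, Finset.mul_sum] at this
    rw [← this]
    refine Finset.sum_congr rfl fun i _ => ?_
    ring
  have hlim : Tendsto (fun n => w ⬝ᵥ gradPairing (fun x => F x * mollify F n x) ψ) atTop
      (nhds (w ⬝ᵥ gradPairing (fun x => F x ^ 2) ψ)) := by
    refine tendsto_finsetSum _ fun i _ => Tendsto.const_mul _ ?_
    refine tendsto_integral_of_dominated_convergence
      (fun x => C * C * ‖fderiv ℝ ψ x (Pi.single i 1)‖) (fun n => ?_) ?_ (fun n => ?_) ?_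
    · exact (hF.mul (hsm n).continuous.aestronglyMeasurable).mul
        (hψ.continuous_fderiv_apply _).aestronglyMeasurable
    · exact ((hψ.continuous_fderiv_apply _).integrable_of_hasCompactSupport
        (hψ.hasCompactSupport.fderiv_apply ℝ _)).norm.const_mul _
    · refine Eventually.of_forall fun x => ?_
      rw [norm_mul, norm_mul]
      exact mul_le_mul_of_nonneg_right (mul_le_mul (hC x) (norm_mollify_le hF hC n x)
        (norm_nonneg _) ((norm_nonneg _).trans (hC x))) (norm_nonneg _)
    · filter_upwards [ae_tendsto_mollify hloc] with x hx
      rw [pow_two]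
      exact (hx.const_mul _).mul_const _
  exact tendsto_nhds_unique hlim (tendsto_const_nhds.congr' (hzero.mono fun _ h => h.symm))

theorem exists_ae_eq_const_near (hΩ : IsOpen Ω) (hF : LocallyIntegrable F)
    (hw : ∀ w, WeakDirDerivZero Ω w F) {x : Fin m → ℝ} (hx : x ∈ Ω) :
    ∃ c, ∃ r > 0, ∀ᵐ y ∂(volume.restrict (ball x r)), F y = c := by
  obtain ⟨r, hr, hsub⟩ := Metric.nhds_basis_closedBall.mem_iff.1 (hΩ.mem_nhds hx)
  have hconst : ∀ᶠ n in atTop, ∀ y ∈ ball x r, ∀ z ∈ ball x r,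
      mollify F n y = mollify F n z := by
    filter_upwards [eventually_forall_closedBall_subset hΩ (isCompact_closedBall x r) hsub] with n hn
    have hdiff := (contDiff_mollify hF n).differentiable (by simp)
    intro y hy z hz
    refine isOpen_ball.is_const_of_fderiv_eq_zero (𝕜 := ℝ) (convex_ball x r).isPreconnected
      hdiff.differentiableOn (fun p hp => ?_) hy hz
    refine ContinuousLinearMap.coe_injective ((Pi.basisFun ℝ (Fin m)).ext fun i => ?_)
    have := (hw (Pi.single i 1)).sum_mul_fderiv_mollify_eq_zero hF (hn p (ball_subset_closedBall hp))
    simpa [Pi.single_apply] using this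
  have hae := ae_restrict_of_ae (s := ball x r) (ae_tendsto_mollify hF)
  have : (ae (volume.restrict (ball x r))).NeBot := by
    rw [ae_neBot, Ne, Measure.restrict_eq_zero]
    exact (measure_ball_pos volume x hr).ne'
  have hae' := hae.and (ae_restrict_mem measurableSet_ball)
  obtain ⟨z, hz, hzb⟩ := hae'.exists
  refine ⟨F z, r, hr, ?_⟩
  filter_upwards [hae'] with y hy
  refine tendsto_nhds_unique hy.1 (hz.congr' ?_)
  filter_upwards [hconst] with n hn using hn z hzb y hy.2

/-- A function with vanishing weak gradient on a connected open set is a.e. constant there. -/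
theorem exists_ae_eq_const (hΩ : IsOpen Ω) (hΩc : IsConnected Ω) (hF : LocallyIntegrable F)
    (hw : ∀ w, WeakDirDerivZero Ω w F) :
    ∃ c, ∀ᵐ y ∂(volume.restrict Ω), F y = c := by
  set U : ℂ → Set (Fin m → ℝ) := fun c =>
    {x | ∃ r > 0, ∀ᵐ y ∂(volume.restrict (ball x r)), F y = c} with hU
  have hopen : ∀ c, IsOpen (U c) := by
    intro c
    refine Metric.isOpen_iff.2 ?_
    rintro x ⟨r, hr, h⟩
    refine ⟨r, hr, fun y hy => ⟨r - dist y x, sub_pos.2 hy, ?_⟩⟩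
    exact ae_restrict_of_ae_restrict_of_subset (ball_subset_ball' (by simp)) h
  have hdisj : ∀ c d, c ≠ d → Disjoint (U c) (U d) := by
    intro c d hcd
    rw [Set.disjoint_left]
    rintro x ⟨r, hr, h⟩ ⟨s, hs, h'⟩
    have h1 := ae_restrict_of_ae_restrict_of_subset (ball_subset_ball (min_le_left r s)) h
    have h2 := ae_restrict_of_ae_restrict_of_subset (ball_subset_ball (min_le_right r s)) h'
    have : (ae (volume.restrict (ball x (min r s)))).NeBot := by
      rw [ae_neBot, Ne, Measure.restrict_eq_zero]
      exact (measure_ball_pos volume x (lt_min hr hs)).ne'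
    obtain ⟨z, hz1, hz2⟩ := (h1.and h2).exists
    exact hcd (hz1.symm.trans hz2)
  obtain ⟨x₀, hx₀⟩ := hΩc.nonempty
  obtain ⟨c, hc⟩ := exists_ae_eq_const_near hΩ hF hw hx₀
  have hsub : Ω ⊆ U c := by
    refine IsPreconnected.subset_left_of_subset_union (hopen c)
      (isOpen_biUnion fun d (_ : d ∈ ({c}ᶜ : Set ℂ)) => hopen d) ?_ ?_ ⟨x₀, hx₀, hc⟩
      hΩc.isPreconnected
    · exact Set.disjoint_iUnion₂_right.2 fun d hd => hdisj c d (Ne.symm hd)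
    · intro x hx
      obtain ⟨d, hd⟩ := exists_ae_eq_const_near hΩ hF hw hx
      by_cases hdc : d = c
      · exact Or.inl (hdc ▸ hd)
      · exact Or.inr (mem_biUnion (x := d) hdc hd)
  refine ⟨c, ?_⟩
  rw [ae_restrict_iff' hΩ.measurableSet]
  refine measure_null_of_locally_null _ fun x hx => ?_
  have hxΩ : x ∈ Ω := by
    by_contra h
    exact hx fun h' => absurd h' h
  obtain ⟨r, hr, h⟩ := hsub hxΩ
  rw [ae_restrict_iff' measurableSet_ball] at h
  refine ⟨_, inter_mem_nhdsWithin _ (ball_mem_nhds x hr), measure_mono_null ?_ h⟩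
  rintro y ⟨hy, hyb⟩ hy'
  exact hy fun _ => hy' hyb

end Mollification

/-- If `∇χ₁ + B ∇χ₂ = 0` for indicators of disjoint sets and neither `0` nor `1` is an eigenvalue
of `B`, then both gradients vanish. -/
theorem weakDirDerivZero_of_gradPairing_relation {m : ℕ} {Ω S₁ S₂ : Set (Fin m → ℝ)}
    (hΩ : IsOpen Ω) (hS₁ : MeasurableSet S₁) (hS₂ : MeasurableSet S₂) (hS : Disjoint S₁ S₂)
    {B : Matrix (Fin m) (Fin m) ℝ} (hB : B.det ≠ 0) (hB' : (1 - B).det ≠ 0)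
    (hrel : ∀ ψ, IsTestFunction Ω ψ → gradPairing (S₁.indicator 1) ψ +
      B.map Complex.ofReal *ᵥ gradPairing (S₂.indicator 1) ψ = 0) (w : Fin m → ℂ) :
    WeakDirDerivZero Ω w (S₁.indicator 1) ∧ WeakDirDerivZero Ω w (S₂.indicator 1) := by
  set B' : Matrix (Fin m) (Fin m) ℂ := B.map Complex.ofReal
  have hdet : B'.det ≠ 0 := by
    have : B'.det = ((B.det : ℝ) : ℂ) := (RingHom.map_det Complex.ofRealHom B).symm
    rw [this]; exact_mod_cast hB
  have hdet' : (1 - B').det ≠ 0 := by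
    have h1 : 1 - B' = (1 - B).map Complex.ofReal := by
      rw [Matrix.map_sub _ (by simp), Matrix.map_one _ (by simp) (by simp)]
    have : (1 - B').det = (((1 - B).det : ℝ) : ℂ) := by
      rw [h1]; exact (RingHom.map_det Complex.ofRealHom (1 - B)).symm
    rw [this]; exact_mod_cast hB'
  set T : Module.End ℂ (Fin m → ℂ) := B'.vecMulLinear with hT
  set P : (Set (Fin m → ℝ)) → {ψ // IsTestFunction Ω ψ} → (Fin m → ℂ) →ₗ[ℂ] ℂ := fun S ψ =>
    (dotProductBilin ℂ ℂ).flip (gradPairing (S.indicator 1) ψ.1) with hP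
  have hPapp : ∀ S ψ w, P S ψ w = w ⬝ᵥ gradPairing (S.indicator 1) ψ.1 := fun _ _ _ => rfl
  have main := Module.End.forall_eq_zero_of_eigenvalue T (P S₁) (P S₂) (fun ψ w => ?_) ?_
  · exact ⟨fun ψ hψ => (main w ⟨ψ, hψ⟩).1, fun ψ hψ => (main w ⟨ψ, hψ⟩).2⟩
  · have := congrArg (fun g => w ⬝ᵥ g) (hrel ψ.1 ψ.2)
    simpa [hPapp, hT, dotProduct_add, dotProduct_mulVec] using this
  · intro μ hμ w hw
    obtain ⟨v, hv, hv0⟩ := hμ.exists_hasEigenvector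
    rw [Module.End.mem_eigenspace_iff] at hv
    replace hv : v ᵥ* B' = μ • v := hv
    have hμ0 : μ ≠ 0 := by
      rintro rfl
      exact hv0 (eq_zero_of_vecMul_eq_zero hdet (by simpa using hv))
    have hμ1 : μ ≠ 1 := by
      rintro rfl
      refine hv0 (eq_zero_of_vecMul_eq_zero hdet' ?_)
      rw [vecMul_sub, hv]; simp
    set F : (Fin m → ℝ) → ℂ := fun x => S₁.indicator 1 x + μ * S₂.indicator 1 x with hF
    have hFw : WeakDirDerivZero Ω w F := by
      intro ψ hψ
      rw [hF, gradPairing_add_smul hψ (locallyIntegrable_indicator_one hS₁)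
        (locallyIntegrable_indicator_one hS₂)]
      simpa [hPapp] using hw ⟨ψ, hψ⟩
    have hFm : AEStronglyMeasurable F :=
      (aestronglyMeasurable_indicator_one hS₁).add
        ((aestronglyMeasurable_indicator_one hS₂).const_mul μ)
    have hFsq := hFw.sq hΩ hFm (C := 1 + ‖μ‖ * 1) fun x => (norm_add_le _ _).trans <| by
      rw [norm_mul]
      gcongr <;> exact norm_indicator_one_le _ _
    have hFsq' : (fun x => F x ^ 2) = fun x => S₁.indicator 1 x + μ ^ 2 * S₂.indicator 1 x := by
      ext x
      by_cases h1 : x ∈ S₁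
      · simp [hF, h1, Set.disjoint_left.1 hS h1]
      · by_cases h2 : x ∈ S₂ <;> simp [hF, h1, h2]
    rw [hFsq'] at hFsq
    intro ψ
    have e1 := hw ψ
    have e2 := hFsq ψ.1 ψ.2
    rw [gradPairing_add_smul ψ.2 (locallyIntegrable_indicator_one hS₁)
      (locallyIntegrable_indicator_one hS₂), dotProduct_add, dotProduct_smul,
      ← hPapp, ← hPapp, smul_eq_mul] at e2
    have e3 : μ * (μ - 1) * P S₂ ψ w = 0 := by linear_combination e2 - e1
    have e4 : P S₂ ψ w = 0 := by
      simpa [hμ0, sub_ne_zero.2 hμ1] using e3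
    exact ⟨by simpa [e4] using e1, e4⟩

theorem gradPairing_relation_of_AFree {m n N : ℕ} (A : Fin m → Matrix (Fin N) (Fin n) ℝ)
    {Ω S₁ S₂ : Set (Fin m → ℝ)} (hS₁ : MeasurableSet S₁) (hS₂ : MeasurableSet S₂)
    {u : (Fin m → ℝ) → (Fin n → ℝ)} {a₀ b₁ b₂ : Fin n → ℝ}
    (hu : ∀ᵐ x ∂(volume.restrict Ω),
      u x = a₀ + (S₁.indicator 1 x : ℝ) • b₁ + (S₂.indicator 1 x : ℝ) • b₂)
    (hfree : ∀ φ : (Fin m → ℝ) → (Fin N → ℝ), ContDiff ℝ (⊤ : ℕ∞) φ →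
      HasCompactSupport φ → tsupport φ ⊆ Ω →
      ∫ x in Ω, u x ⬝ᵥ (∑ i, (A i)ᵀ.mulVec (fderiv ℝ φ x (Pi.single i 1))) = 0)
    {ψ : (Fin m → ℝ) → ℂ} (hψ : IsTestFunction Ω ψ) (y : Fin N → ℝ) :
    ∑ i, ((y ⬝ᵥ A i *ᵥ b₁ : ℝ) : ℂ) * gradPairing (S₁.indicator 1) ψ i +
      ∑ i, ((y ⬝ᵥ A i *ᵥ b₂ : ℝ) : ℂ) * gradPairing (S₂.indicator 1) ψ i = 0 := by
  set H : Fin m → (Fin m → ℝ) → ℂ := fun i x => ((y ⬝ᵥ A i *ᵥ a₀ : ℝ) : ℂ) +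
    ((y ⬝ᵥ A i *ᵥ b₁ : ℝ) : ℂ) * S₁.indicator 1 x +
      ((y ⬝ᵥ A i *ᵥ b₂ : ℝ) : ℂ) * S₂.indicator 1 x with hH
  have hint₁ := fun i => (hψ.integrable_mul_fderiv
    (locallyIntegrable_indicator_one hS₁) (Pi.single i 1)).const_mul
    ((y ⬝ᵥ A i *ᵥ b₁ : ℝ) : ℂ)
  have hint₂ := fun i => (hψ.integrable_mul_fderiv
    (locallyIntegrable_indicator_one hS₂) (Pi.single i 1)).const_mul
    ((y ⬝ᵥ A i *ᵥ b₂ : ℝ) : ℂ)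
  have hint₀ := fun i => hψ.integrable_mul_fderiv
    (locallyIntegrable_const ((y ⬝ᵥ A i *ᵥ a₀ : ℝ) : ℂ)) (Pi.single i 1)
  have hHeq : ∀ i, (fun x => H i x * fderiv ℝ ψ x (Pi.single i 1)) = fun x =>
      ((y ⬝ᵥ A i *ᵥ a₀ : ℝ) : ℂ) * fderiv ℝ ψ x (Pi.single i 1) +
      ((y ⬝ᵥ A i *ᵥ b₁ : ℝ) : ℂ) * (S₁.indicator 1 x * fderiv ℝ ψ x (Pi.single i 1)) +
      ((y ⬝ᵥ A i *ᵥ b₂ : ℝ) : ℂ) * (S₂.indicator 1 x * fderiv ℝ ψ x (Pi.single i 1)) := by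
    intro i; ext x; simp only [hH]; ring
  have hHint : ∀ i, Integrable fun x => H i x * fderiv ℝ ψ x (Pi.single i 1) := by
    intro i
    rw [hHeq]
    exact ((hint₀ i).add (hint₁ i)).add (hint₂ i)
  have hsum : ∑ i, ((y ⬝ᵥ A i *ᵥ b₁ : ℝ) : ℂ) * gradPairing (S₁.indicator 1) ψ i +
      ∑ i, ((y ⬝ᵥ A i *ᵥ b₂ : ℝ) : ℂ) * gradPairing (S₂.indicator 1) ψ i =
      ∫ x, ∑ i, H i x * fderiv ℝ ψ x (Pi.single i 1) := by
    rw [integral_finsetSum _ fun i _ => hHint i, ← Finset.sum_add_distrib]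
    refine Finset.sum_congr rfl fun i _ => ?_
    have h0 := congrFun (gradPairing_const hψ ((y ⬝ᵥ A i *ᵥ a₀ : ℝ) : ℂ)) i
    simp only [gradPairing, Pi.zero_apply] at h0
    have h01 := (hint₀ i).add (hint₁ i)
    simp only [Pi.add_def] at h01
    rw [hHeq, integral_add h01 (hint₂ i), integral_add (hint₀ i) (hint₁ i), h0,
      integral_const_mul, integral_const_mul, zero_add]
    rfl
  have hτ : ∀ τ : ℂ →L[ℝ] ℝ, (∀ (r : ℝ) (z : ℂ), τ (r * z) = r * τ z) →
      τ (∫ x, ∑ i, H i x * fderiv ℝ ψ x (Pi.single i 1)) = 0 := by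
    intro τ hτr
    have hsupp : tsupport (fun x => τ (ψ x) • y) ⊆ tsupport ψ := by
      refine closure_mono fun x hx => ?_
      contrapose! hx
      simp_all
    have hφ := hfree (fun x => τ (ψ x) • y) ((τ.contDiff.comp hψ.contDiff).smul contDiff_const)
      (hψ.hasCompactSupport.mono' ((subset_tsupport _).trans hsupp))
      (hsupp.trans hψ.tsupport_subset)
    rw [← τ.integral_comp_comm (integrable_finsetSum _ fun i _ => hHint i), ← hφ]
    rw [← setIntegral_eq_integral_of_forall_compl_eq_zero (s := Ω)]
    · refine integral_congr_ae ?_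
      filter_upwards [hu] with x hx
      have hfd : ∀ v, fderiv ℝ (fun x => τ (ψ x) • y) x v = τ (fderiv ℝ ψ x v) • y := by
        intro v
        have h1 : HasFDerivAt (fun x => τ (ψ x)) (τ.comp (fderiv ℝ ψ x)) x :=
          τ.hasFDerivAt.comp x (hψ.contDiff.differentiable (by simp) x).hasFDerivAt
        rw [(h1.smul_const y).fderiv]
        simp
      have hHx : ∀ i, H i x = ((y ⬝ᵥ A i *ᵥ u x : ℝ) : ℂ) := by
        intro i
        rw [hx]
        simp only [hH, mulVec_add, mulVec_smul, dotProduct_add, dotProduct_smul, smul_eq_mul]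
        by_cases h1 : x ∈ S₁ <;> by_cases h2 : x ∈ S₂ <;> simp [h1, h2]
      simp only [map_sum, hfd, hHx, hτr, dotProduct_sum, mulVec_smul, dotProduct_smul,
        smul_eq_mul]
      refine Finset.sum_congr rfl fun i _ => ?_
      rw [mul_comm, mulVec_transpose, dotProduct_comm (u x), dotProduct_mulVec]
    · intro x hx
      have : fderiv ℝ ψ x = 0 := by
        have hx' : x ∉ tsupport ψ := fun h => hx (hψ.tsupport_subset h)
        exact image_eq_zero_of_notMem_tsupport fun h => hx' (tsupport_fderiv_subset ℝ h)
      simp [this]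
  rw [hsum]
  exact Complex.ext (hτ Complex.reCLM (by simp)) (hτ Complex.imCLM (by simp))

/-- **Rigidity of the three-state problem for operators of order 1.** If `u ∈ L^∞(Ω;ℝ^n)` takes
a.e. three values `a 0, a 1, a 2` with pairwise differences outside the wave cone of a first
order homogeneous operator `𝒜`, and `𝒜(u) = 0` distributionally on the open connected set `Ω`,
then `u` is a.e. constant. -/
theorem three_state_rigidity_order_one
    {m n N : ℕ}
    (A : Fin m → Matrix (Fin N) (Fin n) ℝ)
    (Ω : Set (Fin m → ℝ)) (hΩo : IsOpen Ω) (hΩc : IsConnected Ω)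
    (a : Fin 3 → (Fin n → ℝ))
    (hdiff : ∀ i j : Fin 3, i ≠ j →
      a i - a j ∉ {η : Fin n → ℝ | ∃ ξ : Fin m → ℝ, ξ ≠ 0 ∧ (∑ i', ξ i' • A i').mulVec η = 0})
    (u : (Fin m → ℝ) → (Fin n → ℝ))
    (hmeas : AEStronglyMeasurable u (volume.restrict Ω))
    (hbdd : ∃ M : ℝ, ∀ᵐ x ∂(volume.restrict Ω), ‖u x‖ ≤ M)
    (hval : ∀ᵐ x ∂(volume.restrict Ω), u x ∈ Set.range a)
    (hfree : ∀ φ : (Fin m → ℝ) → (Fin N → ℝ), ContDiff ℝ (⊤ : ℕ∞) φ →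
      HasCompactSupport φ → tsupport φ ⊆ Ω →
      ∫ x in Ω, u x ⬝ᵥ (∑ i, (A i)ᵀ.mulVec (fderiv ℝ φ x (Pi.single i 1))) = 0) :
    ∃ c : Fin n → ℝ, ∀ᵐ x ∂(volume.restrict Ω), u x = c := by
  rcases Nat.eq_zero_or_pos m with rfl | hm
  · exact ⟨u 0, Eventually.of_forall fun x => by rw [Subsingleton.elim x 0]⟩
  have hinj : ∀ i j, a i = a j → i = j := by
    intro i j hij
    by_contra hne
    refine hdiff i j hne ⟨Pi.single ⟨0, hm⟩ 1, by simp, ?_⟩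
    rw [hij, sub_self, mulVec_zero]
  set L : (Fin n → ℝ) → Matrix (Fin N) (Fin m) ℝ := fun b => Matrix.of fun r i => (A i *ᵥ b) r
    with hL
  have hLinj : ∀ i j, i ≠ j → Function.Injective (L (a i - a j)).mulVec := by
    intro i j hij
    refine LinearMap.ker_eq_bot.1
      (LinearMap.ker_eq_bot'.2 fun ξ hξ => ?_ : LinearMap.ker (L (a i - a j)).mulVecLin = ⊥)
    by_contra hξ0
    refine hdiff i j hij ⟨ξ, hξ0, ?_⟩
    rw [← hξ]
    ext r
    simp only [sum_mulVec, smul_mulVec, Finset.sum_apply, Pi.smul_apply, smul_eq_mul]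
    exact Finset.sum_congr rfl fun i _ => mul_comm _ _
  obtain ⟨P, hP₁, hP₂, hP₃⟩ := Matrix.exists_common_left_inverse (hLinj 1 0 (by decide))
    (hLinj 2 0 (by decide)) (hLinj 1 2 (by decide))
  have hLsub : L (a 1 - a 2) = L (a 1 - a 0) - L (a 2 - a 0) := by
    ext r i
    simp [hL, mulVec_sub]
  rw [hLsub, Matrix.mul_sub, hP₁] at hP₃
  set v := hmeas.mk u with hv
  have hvm : Measurable v := hmeas.stronglyMeasurable_mk.measurable
  set S : Fin 3 → Set (Fin m → ℝ) := fun j => v ⁻¹' {a j} with hS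
  have hSm : ∀ j, MeasurableSet (S j) := fun j => hvm (measurableSet_singleton _)
  have hmem : ∀ x j k, v x = a j → (x ∈ S k ↔ j = k) := fun x j k hx => by
    simp only [hS, mem_preimage, mem_singleton_iff, hx]
    exact ⟨hinj j k, fun h => h ▸ rfl⟩
  have hdisj : Disjoint (S 1) (S 2) := Set.disjoint_left.2 fun x h1 h2 =>
    absurd ((hmem x 1 2 h1).1 h2) (by decide)
  have hu : ∀ᵐ x ∂(volume.restrict Ω), u x = a 0 + ((S 1).indicator 1 x : ℝ) • (a 1 - a 0) +
      ((S 2).indicator 1 x : ℝ) • (a 2 - a 0) := by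
    filter_upwards [hval, hmeas.ae_eq_mk] with x hx hxv
    obtain ⟨j, hj⟩ := hx
    have hk := fun k => hmem x j k (hxv.symm.trans hj.symm)
    rw [← hj]
    fin_cases j <;> simp [hk]
  have hrel : ∀ ψ, IsTestFunction Ω ψ → gradPairing ((S 1).indicator 1) ψ +
      (P * L (a 2 - a 0)).map Complex.ofReal *ᵥ gradPairing ((S 2).indicator 1) ψ = 0 := by
    intro ψ hψ
    have hone : ((P * L (a 1 - a 0)).map Complex.ofReal : Matrix (Fin m) (Fin m) ℂ) = 1 := by
      rw [hP₁, Matrix.map_one _ (by simp) (by simp)]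
    conv_lhs => rw [← one_mulVec (gradPairing ((S 1).indicator 1) ψ), ← hone]
    ext k
    exact gradPairing_relation_of_AFree A (hSm 1) (hSm 2) hu hfree hψ (P k)
  have hzero := weakDirDerivZero_of_gradPairing_relation hΩo (hSm 1) (hSm 2) hdisj hP₂ hP₃ hrel
  obtain ⟨c₁, hc₁⟩ := exists_ae_eq_const hΩo hΩc
    (locallyIntegrable_indicator_one (hSm 1)) fun w => (hzero w).1
  obtain ⟨c₂, hc₂⟩ := exists_ae_eq_const hΩo hΩc
    (locallyIntegrable_indicator_one (hSm 2)) fun w => (hzero w).2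
  refine ⟨a 0 + c₁.re • (a 1 - a 0) + c₂.re • (a 2 - a 0), ?_⟩
  filter_upwards [hu, hc₁, hc₂] with x hx h1 h2
  have hre : ∀ j, ((S j).indicator (1 : (Fin m → ℝ) → ℂ) x).re = (S j).indicator 1 x := by
    intro j
    by_cases hxj : x ∈ S j <;> simp [hxj]
  rw [hx, ← h1, ← h2, hre, hre]
end
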